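/- arXiv:1512.06001 — 5 statements merged into one kernel-verified Lean document; each statement's English description precedes it below -/
import Mathlib

section
/- Let 𝒜 be a Grothendieck abelian category and let S be a set of objects of 𝒜 containing a generator. Let 𝒴 = S^⊥ = {Y : Ext¹(S,Y) = 0 for all S ∈ S} and let 𝒳 = ^⊥𝒴 = {X : Ext¹(X,Y) = 0 for all Y ∈ 𝒴}. Then (𝒳, 𝒴) is a complete cotorsion pair in 𝒜; that is, 𝒳^⊥ = 𝒴 and ^⊥𝒴 = 𝒳, and every object A of 𝒜 admits a short exact sequence 0 → Y → X → A → 0 with X ∈ 𝒳 and Y ∈ 𝒴, and a short exact sequence 0 → A → Y' → X' → 0 with X' ∈ 𝒳 and Y' ∈ 𝒴. -/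
open CategoryTheory Limits ZeroObject

namespace AbModel

variable {A : Type*} [Category A] [Abelian A]

/-- `0 → X₁ → X₂ → X₃ → 0` given by `f, g` is a short exact sequence. -/
def IsSES {X₁ X₂ X₃ : A} (f : X₁ ⟶ X₂) (g : X₂ ⟶ X₃) : Prop :=
  ∃ w : f ≫ g = 0, (ShortComplex.mk f g w).ShortExact

/-- There exists a short exact sequence `0 → X₁ → X₂ → X₃ → 0`. -/
def SES (X₁ X₂ X₃ : A) : Prop :=
  ∃ (f : X₁ ⟶ X₂) (g : X₂ ⟶ X₃), IsSES f g

/-- `Ext¹(X, Y) = 0`, expressed as: every short exact sequence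
`0 → Y → Z → X → 0` splits. -/
def Ext1IsZero (X Y : A) : Prop :=
  ∀ ⦃Z : A⦄ (f : Y ⟶ Z) (g : Z ⟶ X) (w : f ≫ g = 0),
    (ShortComplex.mk f g w).ShortExact → Nonempty (ShortComplex.mk f g w).Splitting

/-- The right `Ext¹`-orthogonal class of a class of objects. -/
def rightPerp (S : Set A) : Set A := {Y | ∀ X ∈ S, Ext1IsZero X Y}

/-- The left `Ext¹`-orthogonal class of a class of objects. -/
def leftPerp (S : Set A) : Set A := {X | ∀ Y ∈ S, Ext1IsZero X Y}

/-- `(X, Y)` is a cotorsion pair. -/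
def IsCotorsionPair (X Y : Set A) : Prop :=
  X = leftPerp Y ∧ Y = rightPerp X

/-- Completeness of a pair of classes: every object has the two approximation
short exact sequences. -/
def IsCompletePair (X Y : Set A) : Prop :=
  (∀ M : A, ∃ Q W : A, Q ∈ X ∧ W ∈ Y ∧ SES W Q M) ∧
  (∀ M : A, ∃ Q W : A, Q ∈ X ∧ W ∈ Y ∧ SES M W Q)

/-- `(X, Y)` is a complete cotorsion pair. -/
def IsCompleteCotorsionPair (X Y : Set A) : Prop :=
  IsCotorsionPair X Y ∧ IsCompletePair X Y

/-- The hereditary condition on a pair of classes: the left class is closed under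
kernels of epimorphisms between its objects, and the right class is closed under
cokernels of monomorphisms between its objects. -/
def IsHereditaryPair (X Y : Set A) : Prop :=
  (∀ ⦃K B B' : A⦄, B ∈ X → B' ∈ X → SES K B B' → K ∈ X) ∧
  (∀ ⦃B B' Q : A⦄, B ∈ Y → B' ∈ Y → SES B B' Q → Q ∈ Y)

/-- A thick class: closed under direct summands (retracts) and satisfying
two-out-of-three for short exact sequences. -/
def IsThick (W : Set A) : Prop :=
  (∀ ⦃X Y : A⦄, Y ∈ W → (∃ (i : X ⟶ Y) (r : Y ⟶ X), i ≫ r = 𝟙 X) → X ∈ W) ∧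
  (∀ ⦃X Y Z : A⦄, SES X Y Z →
    (X ∈ W → Y ∈ W → Z ∈ W) ∧ (X ∈ W → Z ∈ W → Y ∈ W) ∧ (Y ∈ W → Z ∈ W → X ∈ W))

/-- A Hovey triple `(Q, W, R)`: `W` is thick and `(Q, W ∩ R)`, `(Q ∩ W, R)` are
complete cotorsion pairs. -/
def IsHoveyTriple (Q W R : Set A) : Prop :=
  IsThick W ∧ IsCompleteCotorsionPair Q (W ∩ R) ∧ IsCompleteCotorsionPair (Q ∩ W) R

/-- A hereditary Hovey triple. -/
def IsHereditaryHoveyTriple (Q W R : Set A) : Prop :=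
  IsHoveyTriple Q W R ∧ IsHereditaryPair Q (W ∩ R) ∧ IsHereditaryPair (Q ∩ W) R

end AbModel

open AbModel

namespace CategoryTheory.IsGrothendieckAbelian

section

universe w v u

open MorphismProperty in
/-- In a Grothendieck abelian category, any small family of monomorphisms permits the
small object argument. -/
lemma hasSmallObjectArgument_of_le_monomorphisms
    {C : Type u} [Category.{v} C] [Abelian C] [IsGrothendieckAbelian.{w} C]
    (I : MorphismProperty C) [IsSmall.{w} I] (hI : I ≤ monomorphisms C) :
    HasSmallObjectArgument.{w} I := by
  have : Small.{w} I.toSet := IsSmall.small_toSet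
  obtain ⟨κ, hκ', hκ⟩ :=
    HasCardinalLT.exists_regular_cardinal.{w} (Σ f : I.toSet, Subobject f.1.left)
  have : Fact κ.IsRegular := ⟨hκ'⟩
  have : Nonempty κ.ord.ToType := by simpa using hκ'.ne_zero
  have := WellFoundedLT.toOrderBot κ.ord.ToType
  exact ⟨κ, inferInstance, inferInstance,
    { preservesColimit {A B X Y} i hi f hf := by
        let hf' : (monomorphisms C).TransfiniteCompositionOfShape κ.ord.ToType f :=
          { toTransfiniteCompositionOfShape := hf.toTransfiniteCompositionOfShape
            map_mem j hj := by
              have := (hf.attachCells j hj).pushouts_coproducts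
              simp only [ofHoms_homFamily] at this
              refine (?_ : _ ≤ monomorphisms C) _ this
              simpa only [pushouts_le_iff, coproducts_le_iff] using hI }
        have (j j' : κ.ord.ToType) (φ : j ⟶ j') : Mono (hf'.F.map φ) := hf'.mem_map φ
        apply preservesColimit_coyoneda_obj_of_mono (Y := hf'.F) (κ := κ)
        exact hκ.of_injective
          (fun S ↦ (⟨⟨Arrow.mk i, hi⟩, S⟩ : Σ f : I.toSet, Subobject f.1.left))
          (fun S T h ↦ by simpa using h) }⟩

end

end CategoryTheory.IsGrothendieckAbelian

namespace AbModel

section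

variable {A : Type u} [Category.{v} A] [Abelian A]

lemma shortExact_of_isZero {Z X : A} (hZ : IsZero Z) (f : Z ⟶ X) :
    (ShortComplex.mk f (𝟙 X) (hZ.eq_of_src _ _)).ShortExact where
  exact := (ShortComplex.exact_iff_mono _ (hZ.eq_of_src _ _)).2 (inferInstanceAs (Mono (𝟙 X)))
  mono_f := ⟨fun _ _ _ ↦ hZ.eq_of_tgt _ _⟩
  epi_g := inferInstanceAs (Epi (𝟙 X))

/-- A monomorphism with cokernel `C` lifts against any epimorphism with kernel `Y` when
`Ext¹(C, Y) = 0`. -/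
lemma Ext1IsZero.hasLiftingProperty {S T : ShortComplex A} (hS : S.ShortExact)
    (hT : T.ShortExact) (h : Ext1IsZero S.X₃ T.X₁) : HasLiftingProperty S.f T.g where
  sq_hasLift {u t} sq := by
    have := hS.mono_f
    have := hS.epi_g
    have := hT.mono_f
    have := hT.epi_g
    let a : S.X₁ ⟶ pullback T.g t := pullback.lift u S.f sq.w
    let b : T.X₁ ⟶ pullback T.g t := pullback.lift T.f 0 (by simp)
    let q : pullback T.g t ⟶ cokernel a := cokernel.π a
    have hbt : b ≫ pullback.snd T.g t = 0 := pullback.lift_snd _ _ _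
    have hbf : b ≫ pullback.fst T.g t = T.f := pullback.lift_fst _ _ _
    have haf : a ≫ pullback.fst T.g t = u := pullback.lift_fst _ _ _
    have hat : a ≫ pullback.snd T.g t = S.f := pullback.lift_snd _ _ _
    have haq : a ≫ q = 0 := cokernel.condition a
    have hq : (ShortComplex.mk a q haq).Exact :=
      ShortComplex.exact_of_g_is_cokernel _ (cokernelIsCokernel a)
    let c : cokernel a ⟶ S.X₃ := cokernel.desc a (pullback.snd T.g t ≫ S.g)
      (by rw [reassoc_of% hat, S.zero])
    have hqc : q ≫ c = pullback.snd T.g t ≫ S.g := cokernel.π_desc _ _ _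
    have hbp : (ShortComplex.mk b (pullback.snd T.g t) hbt).Exact := by
      rw [ShortComplex.exact_iff_exact_up_to_refinements]
      intro X x hx
      dsimp at x hx
      obtain ⟨X', π, hπ, y, hy⟩ := hT.exact.exact_up_to_refinements (x ≫ pullback.fst T.g t)
        (by rw [Category.assoc, pullback.condition, reassoc_of% hx, zero_comp])
      refine ⟨X', π, hπ, y, ?_⟩
      apply pullback.hom_ext
      · simp only [Category.assoc]
        rw [hbf, hy]
      · simp only [Category.assoc]
        rw [hbt, hx]
        simp
    have w : (b ≫ q) ≫ c = 0 := by rw [Category.assoc, hqc, reassoc_of% hbt, zero_comp]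
    have hex : (ShortComplex.mk (b ≫ q) c w).ShortExact := by
      refine { exact := ?_, mono_f := ?_, epi_g := ?_ }
      · rw [ShortComplex.exact_iff_exact_up_to_refinements]
        intro X x hx
        dsimp at x hx
        obtain ⟨X₁, π₁, _, x₁, h₁⟩ := surjective_up_to_refinements_of_epi q x
        obtain ⟨X₂, π₂, _, k, h₂⟩ := hS.exact.exact_up_to_refinements
          (x₁ ≫ pullback.snd T.g t)
          (by rw [Category.assoc, ← hqc, ← reassoc_of% h₁, hx, comp_zero])
        obtain ⟨X₃, π₃, _, y, h₃⟩ := hbp.exact_up_to_refinements (π₂ ≫ x₁ - k ≫ a)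
          (by simp [hat, h₂])
        refine ⟨X₃, π₃ ≫ π₂ ≫ π₁, inferInstance, y, ?_⟩
        dsimp at h₃ ⊢
        rw [← reassoc_of% h₃]
        simp [haq, h₁]
      · refine Preadditive.mono_of_cancel_zero _ fun {X} y hy ↦ ?_
        dsimp at y hy
        obtain ⟨X', π, _, k, hk⟩ := hq.exact_up_to_refinements (y ≫ b) (by simpa using hy)
        dsimp at k hk
        have hk0 : k = 0 := by
          have := hk =≫ pullback.snd T.g t
          simp only [Category.assoc, hbt, hat, comp_zero] at this
          exact (cancel_mono S.f).1 (by rw [← this, zero_comp])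
        have := hk =≫ pullback.fst T.g t
        simp only [Category.assoc, hbf, hk0, zero_comp] at this
        rw [← cancel_epi π, ← cancel_mono T.f]
        simpa using this
      · have : Epi (q ≫ c) := by
          rw [hqc]
          infer_instance
        exact epi_of_epi q c
    obtain ⟨σ⟩ := h (b ≫ q) c w hex
    let τ := ShortComplex.Splitting.ofExactOfRetraction
      (ShortComplex.mk b (pullback.snd T.g t) hbt) hbp (q ≫ σ.r)
      (by simpa using σ.f_r) inferInstance
    have hτ : S.f ≫ τ.s = a := by
      have h₁ : (q ≫ σ.r) ≫ b + pullback.snd T.g t ≫ τ.s = 𝟙 _ := τ.id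
      have h₂ := a ≫= h₁
      rw [Preadditive.comp_add, Category.comp_id, reassoc_of% hat, Category.assoc,
        reassoc_of% haq, zero_comp, zero_add] at h₂
      exact h₂
    refine ⟨⟨⟨τ.s ≫ pullback.fst T.g t, ?_, ?_⟩⟩⟩
    · rw [reassoc_of% hτ, haf]
    · rw [Category.assoc, pullback.condition]
      have h₁ : τ.s ≫ pullback.snd T.g t = 𝟙 _ := τ.s_g
      rw [reassoc_of% h₁]

/-- If a monomorphism lifts against all epimorphisms with kernel `Y`, then its cokernel `C`
satisfies `Ext¹(C, Y) = 0`. -/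
lemma ext1IsZero_of_hasLiftingProperty {S : ShortComplex A} (hS : S.ShortExact) {Y : A}
    (h : ∀ ⦃T : ShortComplex A⦄, T.ShortExact → T.X₁ = Y → HasLiftingProperty S.f T.g) :
    Ext1IsZero S.X₃ Y := by
  intro Z f g w hT
  have := hS.epi_g
  have := h hT rfl
  have sq : CommSq (0 : S.X₁ ⟶ Z) S.f g S.g := ⟨by simp⟩
  obtain ⟨s, hs⟩ := hS.exact.desc' (k := sq.lift) sq.fac_left
  exact ⟨.ofExactOfSection _ hT.exact s
    (by rw [← cancel_epi S.g, reassoc_of% hs]; simp) hT.mono_f⟩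

variable [HasColimits A]

/-- The morphism to `X` from the coproduct of copies of `G` indexed by a set of
morphisms `G ⟶ X`. -/
noncomputable abbrev descOfSet {G X : A} (T : Set (G ⟶ X)) : (∐ fun _ : T ↦ G) ⟶ X :=
  Sigma.desc fun f : T ↦ f.1

/-- The kernels of the epimorphisms to some `G i` from a coproduct of copies of `G₀` indexed by
a set of morphisms `G₀ ⟶ G i`, together with `0 ⟶ G₀`. -/
noncomputable def generatingInclusions {ι : Type v} (G : ι → A) (i₀ : ι) : MorphismProperty A :=
  MorphismProperty.ofHoms
    (fun x : Σ i, { T : Set (G i₀ ⟶ G i) // Epi (descOfSet T) } ↦ kernel.ι (descOfSet x.2.1)) ⊔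
  MorphismProperty.ofHoms (fun _ : PUnit.{v + 1} ↦ (0 : 0 ⟶ G i₀))

variable {ι : Type v} (G : ι → A) (i₀ : ι)

instance : MorphismProperty.IsSmall.{v} (generatingInclusions G i₀) := by
  have (P Q : MorphismProperty A) [MorphismProperty.IsSmall.{v} P]
      [MorphismProperty.IsSmall.{v} Q] : MorphismProperty.IsSmall.{v} (P ⊔ Q) :=
    ⟨small_union P.toSet Q.toSet⟩
  exact this _ _

lemma exists_shortExact_of_generatingInclusions {X Y : A} {f : X ⟶ Y}
    (hf : generatingInclusions G i₀ f) :
    ∃ (i : ι) (g : Y ⟶ G i) (w : f ≫ g = 0), (ShortComplex.mk f g w).ShortExact := by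
  obtain ⟨⟨i, T, _⟩⟩ | ⟨⟨⟩⟩ := hf
  · exact ⟨i, descOfSet T, kernel.condition _,
      { exact := ShortComplex.exact_of_f_is_kernel _ (kernelIsKernel _)
        mono_f := inferInstanceAs (Mono (kernel.ι _)) }⟩
  · exact ⟨i₀, 𝟙 _, _, shortExact_of_isZero (isZero_zero A) 0⟩

lemma generatingInclusions_le_monomorphisms :
    generatingInclusions G i₀ ≤ MorphismProperty.monomorphisms A := by
  intro X Y f hf
  obtain ⟨i, g, w, h⟩ := exists_shortExact_of_generatingInclusions G i₀ hf
  exact h.mono_f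

lemma generatingInclusions_rlp_of_shortExact {T : ShortComplex A} (hT : T.ShortExact)
    (h : ∀ i, Ext1IsZero (G i) T.X₁) : (generatingInclusions G i₀).rlp T.g := by
  intro X Y f hf
  obtain ⟨i, g, w, hS⟩ := exists_shortExact_of_generatingInclusions G i₀ hf
  exact Ext1IsZero.hasLiftingProperty hS hT (h i)

variable {G i₀}

lemma epi_of_generatingInclusions_rlp (hG : IsSeparator (G i₀)) {E B : A} {p : E ⟶ B}
    (hp : (generatingInclusions G i₀).rlp p) : Epi p := by
  refine Preadditive.epi_of_cancel_zero _ fun {Z} a ha ↦ ?_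
  refine (isSeparator_def _).1 hG _ _ fun t ↦ ?_
  have := hp _ (Or.inr ⟨PUnit.unit⟩ : generatingInclusions G i₀ (0 : 0 ⟶ G i₀))
  have sq : CommSq (0 : 0 ⟶ E) (0 : 0 ⟶ G i₀) p t := ⟨by simp⟩
  rw [← sq.fac_right, Category.assoc, ha, comp_zero, comp_zero]

lemma ext1IsZero_of_generatingInclusions_rlp (hG : IsSeparator (G i₀)) {Y : A}
    (hY : (generatingInclusions G i₀).rlp (0 : Y ⟶ 0)) (i : ι) : Ext1IsZero (G i) Y := by
  intro Z f g w hT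
  have := hT.epi_g
  have := hT.mono_f
  let T : Set (G i₀ ⟶ G i) := {t | ∃ l, l ≫ g = t}
  choose l hl using fun t : T ↦ t.2
  let e : (∐ fun _ : T ↦ G i₀) ⟶ Z := Sigma.desc l
  have he : e ≫ g = descOfSet T := by
    apply Sigma.hom_ext
    intro t
    simp [e, hl]
  have hepi : Epi (descOfSet T) := by
    refine Preadditive.epi_of_cancel_zero _ fun {W} a ha ↦ ?_
    rw [← cancel_epi g]
    refine (isSeparator_def _).1 hG _ _ fun t ↦ ?_
    have := Sigma.ι (fun _ : T ↦ G i₀) (⟨t ≫ g, t, rfl⟩ : T) ≫= ha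
    simpa using this
  have hmem : generatingInclusions G i₀ (kernel.ι (descOfSet T)) :=
    Or.inl (MorphismProperty.ofHoms.mk (⟨i, T, hepi⟩ :
      Σ i, { T : Set (G i₀ ⟶ G i) // Epi (descOfSet T) }))
  have := hY _ hmem
  obtain ⟨k, hk⟩ := hT.exact.lift' (kernel.ι (descOfSet T) ≫ e)
    (by simp [he])
  dsimp at k hk
  have sq : CommSq k (kernel.ι (descOfSet T)) (0 : Y ⟶ 0) 0 := ⟨by simp⟩
  have hex : (ShortComplex.mk (kernel.ι (descOfSet T)) (descOfSet T)
    (kernel.condition _)).Exact := ShortComplex.exact_of_f_is_kernel _ (kernelIsKernel _)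
  obtain ⟨s, hs⟩ := hex.desc' (e - sq.lift ≫ f) (by
    dsimp
    rw [Preadditive.comp_sub, sq.fac_left_assoc, hk, sub_self])
  dsimp at s hs
  refine ⟨.ofExactOfSection _ hT.exact s ?_ hT.mono_f⟩
  dsimp
  rw [← cancel_epi (descOfSet T), reassoc_of% hs]
  simp [he, w]

lemma mem_leftPerp_of_llp_rlp {S : ShortComplex A} (hS : S.ShortExact)
    (h : (generatingInclusions G i₀).rlp.llp S.f) :
    S.X₃ ∈ leftPerp {Y : A | ∀ i, Ext1IsZero (G i) Y} := fun _ hY ↦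
  ext1IsZero_of_hasLiftingProperty hS fun _ hT hTY ↦
    h _ (generatingInclusions_rlp_of_shortExact G i₀ hT (hTY ▸ hY))

end

end AbModel

/-- Theorem (Eklof–Trlifaj / Saorín–Šťovíček): in a Grothendieck abelian category
(an abelian category with a separator in which filtered colimits exist and are exact,
i.e. satisfying AB5), any set of objects `G : ι → A` containing a separator (generator)
cogenerates a complete cotorsion pair: with `Y = {Y | Ext¹(G i, Y) = 0 for all i}` and
`X = ᗮY`, the pair `(X, Y)` is a complete cotorsion pair. -/
theorem cotorsion_pair_cogenerated_by_set_is_complete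
    {A : Type u} [Category.{v} A] [Abelian A] [HasColimits A]
    [HasFilteredColimits A] [AB5 A]
    {ι : Type v} (G : ι → A) (hgen : ∃ i, IsSeparator (G i)) :
    IsCompleteCotorsionPair
      (leftPerp {Y : A | ∀ i, Ext1IsZero (G i) Y})
      {Y : A | ∀ i, Ext1IsZero (G i) Y} := by
  obtain ⟨i₀, hG⟩ := hgen
  have : HasSeparator A := ⟨_, hG⟩
  have : IsGrothendieckAbelian.{v} A := {}
  have := IsGrothendieckAbelian.hasSmallObjectArgument_of_le_monomorphisms.{v}
    (generatingInclusions G i₀) (generatingInclusions_le_monomorphisms G i₀)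
  refine ⟨⟨rfl, Set.Subset.antisymm (fun Y hY X hX ↦ hX Y hY)
    fun Y hY i ↦ hY _ fun Y' hY' ↦ hY' i⟩, fun M ↦ ?_, fun M ↦ ?_⟩
  · let F := MorphismProperty.factorizationData (generatingInclusions G i₀).rlp.llp
      (generatingInclusions G i₀).rlp (0 : 0 ⟶ M)
    have : Epi F.p := epi_of_generatingInclusions_rlp hG F.hp
    refine ⟨F.Z, kernel F.p, ?_, ?_, kernel.ι F.p, F.p, kernel.condition _,
      { exact := ShortComplex.exact_of_f_is_kernel _ (kernelIsKernel _)
        mono_f := inferInstanceAs (Mono (kernel.ι _)) }⟩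
    · exact mem_leftPerp_of_llp_rlp (shortExact_of_isZero (isZero_zero A) F.i) F.hi
    · refine ext1IsZero_of_generatingInclusions_rlp hG ?_
      have sq : IsPullback (kernel.ι F.p) (0 : kernel F.p ⟶ 0) F.p 0 :=
        ⟨⟨by simp⟩, ⟨PullbackCone.IsLimit.mk _
          (fun s ↦ kernel.lift F.p s.fst (by rw [s.condition, comp_zero]))
          (fun s ↦ kernel.lift_ι _ _ _) (fun s ↦ (isZero_zero A).eq_of_tgt _ _)
          (fun s m hm _ ↦ by rw [← cancel_mono (kernel.ι F.p), hm, kernel.lift_ι])⟩⟩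
      exact MorphismProperty.of_isPullback sq F.hp
  · let F := MorphismProperty.factorizationData (generatingInclusions G i₀).rlp.llp
      (generatingInclusions G i₀).rlp (0 : M ⟶ 0)
    have : Mono F.i := by
      have h := IsGrothendieckAbelian.llp_rlp_monomorphisms.{v} hG
      exact h.le _ (MorphismProperty.antitone_llp (MorphismProperty.antitone_rlp
        (generatingInclusions_le_monomorphisms G i₀)) _ F.hi)
    have hex : (ShortComplex.mk F.i (cokernel.π F.i) (cokernel.condition _)).ShortExact :=
      { exact := ShortComplex.exact_of_g_is_cokernel _ (cokernelIsCokernel _)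
        epi_g := inferInstanceAs (Epi (cokernel.π _)) }
    refine ⟨cokernel F.i, F.Z, mem_leftPerp_of_llp_rlp hex F.hi, ?_, F.i, cokernel.π F.i, _, hex⟩
    refine ext1IsZero_of_generatingInclusions_rlp hG ?_
    rw [(isZero_zero A).eq_of_tgt 0 F.p]
    exact F.hp
end

section
/- Let 𝒜 be a bicomplete abelian category equipped with a model structure which is abelian, i.e., a morphism is a cofibration (resp. trivial cofibration) if and only if it is a monomorphism whose cokernel is cofibrant (resp. trivially cofibrant), and a morphism is a fibration (resp. trivial fibration) if and only if it is an epimorphism whose kernel is fibrant (resp. trivially fibrant). Let 𝒬 be the class of cofibrant objects, 𝒲 the class of trivial objects, and ℛ the class of fibrant objects. Then 𝒲 is a thick class in 𝒜, and both (𝒬, 𝒲 ∩ ℛ) and (𝒬 ∩ 𝒲, ℛ) are complete cotorsion pairs in 𝒜. -/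
open CategoryTheory Limits ZeroObject

open AbModel

namespace AbModel

variable {C : Type*} [Category C]

/-- `g` is a retract of `f` in the arrow category. -/
def IsRetractOfMap {A B X Y : C} (g : A ⟶ B) (f : X ⟶ Y) : Prop :=
  ∃ (iA : A ⟶ X) (rA : X ⟶ A) (iB : B ⟶ Y) (rB : Y ⟶ B),
    iA ≫ rA = 𝟙 A ∧ iB ≫ rB = 𝟙 B ∧ iA ≫ f = g ≫ iB ∧ f ≫ rB = rA ≫ g

/-- A (Quillen) model structure on a category, in the sense of
Hovey, "Model categories", Definition 1.1.3 (with non-functorial factorizations,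
which suffices for the statement at hand): three classes of morphisms, the weak
equivalences, cofibrations and fibrations, such that the weak equivalences satisfy
two-out-of-three, all three classes are closed under retracts, (trivial) cofibrations
have the left lifting property with respect to (trivial) fibrations, and every
morphism factors both as a cofibration followed by a trivial fibration and as a
trivial cofibration followed by a fibration. -/
structure ModelStructure (C : Type*) [Category C] where
  weq : MorphismProperty C
  cof : MorphismProperty C
  fib : MorphismProperty C
  weq_twoOutOfThree : weq.HasTwoOutOfThreeProperty
  weq_retract : ∀ ⦃A B X Y : C⦄ (g : A ⟶ B) (f : X ⟶ Y),
    IsRetractOfMap g f → weq f → weq g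
  cof_retract : ∀ ⦃A B X Y : C⦄ (g : A ⟶ B) (f : X ⟶ Y),
    IsRetractOfMap g f → cof f → cof g
  fib_retract : ∀ ⦃A B X Y : C⦄ (g : A ⟶ B) (f : X ⟶ Y),
    IsRetractOfMap g f → fib f → fib g
  lift_cof_trivFib : ∀ ⦃A B X Y : C⦄ (i : A ⟶ B) (p : X ⟶ Y),
    cof i → fib p → weq p → HasLiftingProperty i p
  lift_trivCof_fib : ∀ ⦃A B X Y : C⦄ (i : A ⟶ B) (p : X ⟶ Y),
    cof i → weq i → fib p → HasLiftingProperty i p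
  factor_cof_trivFib : ∀ ⦃X Y : C⦄ (f : X ⟶ Y),
    ∃ (Z : C) (i : X ⟶ Z) (p : Z ⟶ Y), cof i ∧ fib p ∧ weq p ∧ i ≫ p = f
  factor_trivCof_fib : ∀ ⦃X Y : C⦄ (f : X ⟶ Y),
    ∃ (Z : C) (i : X ⟶ Z) (p : Z ⟶ Y), cof i ∧ weq i ∧ fib p ∧ i ≫ p = f

variable [HasZeroObject C] [HasZeroMorphisms C] (M : ModelStructure C)

/-- The cofibrant objects: `0 ⟶ X` is a cofibration. -/
def cofibrantObjects : Set C := {X | M.cof (0 : (0 : C) ⟶ X)}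

/-- The trivial objects: `0 ⟶ X` is a weak equivalence. -/
def trivialObjects : Set C := {X | M.weq (0 : (0 : C) ⟶ X)}

/-- The fibrant objects: `X ⟶ 0` is a fibration. -/
def fibrantObjects : Set C := {X | M.fib (0 : X ⟶ (0 : C))}

end AbModel

namespace AbModel

section Retract

variable {A : Type*} [Category A]

/-- A class of objects is closed under retracts. -/
def IsRetractClosed (S : Set A) : Prop :=
  ∀ ⦃X Y : A⦄ (i : X ⟶ Y) (r : Y ⟶ X), i ≫ r = 𝟙 X → Y ∈ S → X ∈ S

lemma IsRetractClosed.of_iso {S : Set A} (hS : IsRetractClosed S) {X Y : A} (e : X ≅ Y)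
    (hY : Y ∈ S) : X ∈ S :=
  hS e.hom e.inv e.hom_inv_id hY

lemma IsRetractClosed.inter {S T : Set A} (hS : IsRetractClosed S) (hT : IsRetractClosed T) :
    IsRetractClosed (S ∩ T) :=
  fun _ _ i r h hY ↦ ⟨hS i r h hY.1, hT i r h hY.2⟩

end Retract

section Abelian

variable {A : Type*} [Category A] [Abelian A]

lemma isSES_kernel {X Y : A} (f : X ⟶ Y) [Epi f] : IsSES (kernel.ι f) f :=
  ⟨kernel.condition f, ⟨ShortComplex.exact_of_f_is_kernel _ (kernelIsKernel f)⟩⟩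

lemma isSES_cokernel {X Y : A} (f : X ⟶ Y) [Mono f] : IsSES f (cokernel.π f) :=
  ⟨cokernel.condition f, ⟨ShortComplex.exact_of_g_is_cokernel _ (cokernelIsCokernel f)⟩⟩

/-- A weak factorization system whose left class consists of the monomorphisms with cokernel
in `S` and whose right class consists of the epimorphisms with kernel in `T` gives a complete
cotorsion pair. -/
theorem isCompleteCotorsionPair_of_factorization {S T : Set A}
    (hS : IsRetractClosed S) (hT : IsRetractClosed T)
    (lift : ∀ ⦃X Y Z V : A⦄ (i : X ⟶ Y) (p : Z ⟶ V), Mono i → cokernel i ∈ S →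
      Epi p → kernel p ∈ T → HasLiftingProperty i p)
    (factor : ∀ ⦃X Y : A⦄ (f : X ⟶ Y), ∃ (Z : A) (i : X ⟶ Z) (p : Z ⟶ Y),
      (Mono i ∧ cokernel i ∈ S) ∧ (Epi p ∧ kernel p ∈ T) ∧ i ≫ p = f) :
    IsCompleteCotorsionPair S T := by
  have ext ⦃X Y : A⦄ (hX : X ∈ S) (hY : Y ∈ T) : Ext1IsZero X Y := by
    intro Z f g w hse
    have hl : HasLiftingProperty (0 : (0 : A) ⟶ X) g :=
      lift _ _ inferInstance (hS.of_iso cokernelZeroIsoTarget hX) hse.epi_g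
        (hT.of_iso ((kernelIsKernel g).conePointUniqueUpToIso hse.fIsKernel) hY)
    have sq : CommSq (0 : (0 : A) ⟶ Z) (0 : (0 : A) ⟶ X) g (𝟙 X) := ⟨by simp⟩
    exact ⟨ShortComplex.Splitting.ofExactOfSection _ hse.exact sq.lift sq.fac_right hse.mono_f⟩
  have left (M : A) : ∃ Q W : A, Q ∈ S ∧ W ∈ T ∧ SES W Q M := by
    obtain ⟨Z, i, p, ⟨_, hi⟩, ⟨_, hp⟩, -⟩ := factor (0 : (0 : A) ⟶ M)
    obtain rfl : i = 0 := (isZero_zero A).eq_of_src _ _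
    exact ⟨Z, _, hS.of_iso cokernelZeroIsoTarget.symm hi, hp, _, _, isSES_kernel p⟩
  have right (M : A) : ∃ Q W : A, Q ∈ S ∧ W ∈ T ∧ SES M W Q := by
    obtain ⟨Z, i, p, ⟨_, hi⟩, ⟨_, hp⟩, -⟩ := factor (0 : M ⟶ (0 : A))
    obtain rfl : p = 0 := (isZero_zero A).eq_of_tgt _ _
    exact ⟨_, Z, hi, hT.of_iso kernelZeroIsoSource.symm hp, _, _, isSES_cokernel i⟩
  refine ⟨⟨subset_antisymm (fun X hX Y hY ↦ ext hX hY) fun X hX ↦ ?_,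
    subset_antisymm (fun Y hY X hX ↦ ext hX hY) fun Y hY ↦ ?_⟩, left, right⟩
  · obtain ⟨Z, K, hZ, hK, f, g, w, hse⟩ := left X
    obtain ⟨s⟩ := hX K hK f g w hse
    exact hS s.s g s.s_g hZ
  · obtain ⟨C, Z, hC, hZ, f, g, w, hse⟩ := right Y
    obtain ⟨s⟩ := hY C hC f g w hse
    exact hT f s.r s.f_r hZ

/-- If a monomorphism `f` factors as `i ≫ p`, then the kernel of `p` agrees with the kernel of
the induced map between the cokernels of `i` and `f`. -/
lemma isSES_kernel_cokernel {X Y Y' Z : A} {f : X ⟶ Y} {g : Y ⟶ Z} (hfg : IsSES f g)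
    (i : X ⟶ Y') (p : Y' ⟶ Y) [Mono i] [Epi p] (fac : i ≫ p = f)
    (q : cokernel i ⟶ Z) (hq : cokernel.π i ≫ q = p ≫ g) :
    IsSES (kernel.ι p ≫ cokernel.π i) q := by
  obtain ⟨w, hse⟩ := hfg
  have : Mono f := hse.mono_f
  have : Epi g := hse.epi_g
  have hi := (isSES_cokernel i).choose_spec.exact
  have mono : Mono (kernel.ι p ≫ cokernel.π i) := by
    refine Preadditive.mono_of_cancel_zero _ fun a ha ↦ ?_
    rw [← Category.assoc] at ha
    let b := hi.lift (a ≫ kernel.ι p) ha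
    have hb : b ≫ i = a ≫ kernel.ι p := hi.lift_f _ _
    have hb0 : b = 0 := by
      rw [← cancel_mono f, ← fac, reassoc_of% hb]
      simp
    rw [← cancel_mono (kernel.ι p), ← hb, hb0]
    simp
  have epi : Epi q := by
    have : Epi (cokernel.π i ≫ q) := hq ▸ inferInstance
    exact epi_of_epi (cokernel.π i) q
  refine ⟨by simp [hq], ⟨?_⟩⟩
  rw [ShortComplex.exact_iff_exact_up_to_refinements]
  intro T x hx
  dsimp at x hx
  obtain ⟨T', e, he, y, hy⟩ := surjective_up_to_refinements_of_epi (cokernel.π i) x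
  have hyg : (y ≫ p) ≫ g = 0 := by
    rw [Category.assoc, ← hq, ← reassoc_of% hy, hx, comp_zero]
  let z := hse.exact.lift (y ≫ p) hyg
  have hz : z ≫ f = y ≫ p := hse.exact.lift_f _ _
  refine ⟨T', e, he, kernel.lift p (y - z ≫ i) (by simp [fac, hz]), ?_⟩
  simp [hy]

end Abelian

section ModelStructure

variable {A : Type*} [Category A] [Abelian A] (M : ModelStructure A)

lemma isRetractClosed_cofibrantObjects : IsRetractClosed (cofibrantObjects M) :=
  fun _ _ i r h hY ↦ M.cof_retract _ _ ⟨𝟙 _, 𝟙 _, i, r, by simp, h, by simp, by simp⟩ hY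

lemma isRetractClosed_trivialObjects : IsRetractClosed (trivialObjects M) :=
  fun _ _ i r h hY ↦ M.weq_retract _ _ ⟨𝟙 _, 𝟙 _, i, r, by simp, h, by simp, by simp⟩ hY

lemma isRetractClosed_fibrantObjects : IsRetractClosed (fibrantObjects M) :=
  fun _ _ i r h hY ↦ M.fib_retract _ _ ⟨i, r, 𝟙 _, 𝟙 _, h, by simp, by simp, by simp⟩ hY

variable {M} in
lemma mem_trivialObjects_iff_of_weq {X Y : A} {f : X ⟶ Y} (hf : M.weq f) :
    X ∈ trivialObjects M ↔ Y ∈ trivialObjects M := by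
  have := M.weq_twoOutOfThree
  have h : (0 : (0 : A) ⟶ X) ≫ f = 0 := zero_comp
  change M.weq _ ↔ M.weq _
  rw [← h]
  exact (M.weq.postcomp_iff (W := M.weq) _ f hf).symm

variable {M} in
lemma weq_of_mem_trivialObjects {X Y : A} (f : X ⟶ Y) (hX : X ∈ trivialObjects M)
    (hY : Y ∈ trivialObjects M) : M.weq f := by
  have := M.weq_twoOutOfThree
  exact M.weq.of_precomp (W' := M.weq) (0 : (0 : A) ⟶ X) f hX (by rw [zero_comp]; exact hY)

variable {M} in
/-- In an abelian model structure, a monomorphism is a weak equivalence if and only if its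
cokernel is trivial. -/
lemma weq_iff_of_isSES
    (hcof : ∀ ⦃X Y : A⦄ (f : X ⟶ Y),
      M.cof f ↔ Mono f ∧ cokernel f ∈ cofibrantObjects M)
    (htrivcof : ∀ ⦃X Y : A⦄ (f : X ⟶ Y),
      (M.cof f ∧ M.weq f) ↔
        Mono f ∧ cokernel f ∈ cofibrantObjects M ∩ trivialObjects M)
    (htrivfib : ∀ ⦃X Y : A⦄ (f : X ⟶ Y),
      (M.fib f ∧ M.weq f) ↔
        Epi f ∧ kernel f ∈ fibrantObjects M ∩ trivialObjects M)
    {X Y Z : A} {f : X ⟶ Y} {g : Y ⟶ Z} (hfg : IsSES f g) :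
    M.weq f ↔ Z ∈ trivialObjects M := by
  have := M.weq_twoOutOfThree
  obtain ⟨Y', i, p, hi, hp, hpw, fac⟩ := M.factor_cof_trivFib f
  obtain ⟨_, hiQ⟩ := (hcof i).1 hi
  obtain ⟨_, hpK⟩ := (htrivfib p).1 ⟨hp, hpw⟩
  let q : cokernel i ⟶ Z := cokernel.desc i (p ≫ g) (by
    rw [reassoc_of% fac, hfg.choose])
  obtain ⟨_, hse⟩ := isSES_kernel_cokernel hfg i p fac q (by simp [q])
  have : Mono (kernel.ι p ≫ cokernel.π i) := hse.mono_f
  have hq : M.weq q := ((htrivfib q).2 ⟨hse.epi_g,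
    ((isRetractClosed_fibrantObjects M).inter (isRetractClosed_trivialObjects M)).of_iso
      ((kernelIsKernel q).conePointUniqueUpToIso hse.fIsKernel) hpK⟩).2
  rw [← mem_trivialObjects_iff_of_weq hq, ← fac, M.weq.postcomp_iff (W := M.weq) i p hpw]
  exact ⟨fun h ↦ ((htrivcof i).1 ⟨hi, h⟩).2.2, fun h ↦ ((htrivcof i).2 ⟨‹_›, hiQ, h⟩).2⟩

end ModelStructure

end AbModel

/-- Theorem (Hovey's correspondence, forward direction): let `A` be a bicomplete abelian
category with a model structure which is abelian, i.e. the (trivial) cofibrations are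
exactly the monomorphisms with (trivially) cofibrant cokernel, and the (trivial)
fibrations are exactly the epimorphisms with (trivially) fibrant kernel.  Let `Q`, `W`,
`R` be the classes of cofibrant, trivial and fibrant objects respectively.  Then `W` is
thick and both `(Q, W ∩ R)` and `(Q ∩ W, R)` are complete cotorsion pairs. -/
theorem hovey_correspondence_of_abelian_model_structure
    {A : Type*} [Category A] [Abelian A] [HasLimits A] [HasColimits A]
    (M : ModelStructure A)
    (hcof : ∀ ⦃X Y : A⦄ (f : X ⟶ Y),
      M.cof f ↔ Mono f ∧ cokernel f ∈ cofibrantObjects M)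
    (htrivcof : ∀ ⦃X Y : A⦄ (f : X ⟶ Y),
      (M.cof f ∧ M.weq f) ↔
        Mono f ∧ cokernel f ∈ cofibrantObjects M ∩ trivialObjects M)
    (hfib : ∀ ⦃X Y : A⦄ (f : X ⟶ Y),
      M.fib f ↔ Epi f ∧ kernel f ∈ fibrantObjects M)
    (htrivfib : ∀ ⦃X Y : A⦄ (f : X ⟶ Y),
      (M.fib f ∧ M.weq f) ↔
        Epi f ∧ kernel f ∈ fibrantObjects M ∩ trivialObjects M) :
    IsThick (trivialObjects M) ∧
    IsCompleteCotorsionPair (cofibrantObjects M)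
      (trivialObjects M ∩ fibrantObjects M) ∧
    IsCompleteCotorsionPair (cofibrantObjects M ∩ trivialObjects M)
      (fibrantObjects M) := by
  have hQ := isRetractClosed_cofibrantObjects M
  have hW := isRetractClosed_trivialObjects M
  have hR := isRetractClosed_fibrantObjects M
  refine ⟨⟨fun X Y hY ⟨i, r, h⟩ ↦ hW i r h hY, fun X Y Z ⟨f, g, hfg⟩ ↦ ?_⟩, ?_, ?_⟩
  · have key := weq_iff_of_isSES hcof htrivcof htrivfib hfg
    exact ⟨fun hX hY ↦ key.1 (weq_of_mem_trivialObjects f hX hY),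
      fun hX hZ ↦ (mem_trivialObjects_iff_of_weq (key.2 hZ)).1 hX,
      fun hY hZ ↦ (mem_trivialObjects_iff_of_weq (key.2 hZ)).2 hY⟩
  · refine isCompleteCotorsionPair_of_factorization hQ (hW.inter hR)
      (fun _ _ _ _ i p hi hiQ hp hpK ↦ ?_) fun _ _ f ↦ ?_
    · have h := (htrivfib p).2 ⟨hp, hpK.symm⟩
      exact M.lift_cof_trivFib i p ((hcof i).2 ⟨hi, hiQ⟩) h.1 h.2
    · obtain ⟨Z, i, p, hi, hp, hpw, fac⟩ := M.factor_cof_trivFib f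
      have h := (htrivfib p).1 ⟨hp, hpw⟩
      exact ⟨Z, i, p, (hcof i).1 hi, ⟨h.1, h.2.symm⟩, fac⟩
  · refine isCompleteCotorsionPair_of_factorization (hQ.inter hW) hR
      (fun _ _ _ _ i p hi hiQ hp hpK ↦ ?_) fun _ _ f ↦ ?_
    · have h := (htrivcof i).2 ⟨hi, hiQ⟩
      exact M.lift_trivCof_fib i p h.1 h.2 ((hfib p).2 ⟨hp, hpK⟩)
    · obtain ⟨Z, i, p, hi, hiw, hp, fac⟩ := M.factor_trivCof_fib f
      exact ⟨Z, i, p, (htrivcof i).1 ⟨hi, hiw⟩, (hfib p).1 hp, fac⟩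
end

section
/- Let 𝒜 be an abelian category and let (𝒬, 𝒲, ℛ) be a Hovey triple in 𝒜. Then the thick class 𝒲 admits the following two characterizations: 𝒲 = {A ∈ 𝒜 : there is a short exact sequence 0 → A → V → W → 0 with V ∈ 𝒲 ∩ ℛ and W ∈ 𝒬 ∩ 𝒲} = {A ∈ 𝒜 : there is a short exact sequence 0 → V' → W' → A → 0 with V' ∈ 𝒲 ∩ ℛ and W' ∈ 𝒬 ∩ 𝒲}. Consequently, 𝒲 is unique: if (𝒬, 𝒱, ℛ) is also a Hovey triple (with the same classes 𝒬 and ℛ), then 𝒱 = 𝒲. -/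
open CategoryTheory Limits ZeroObject

open AbModel

/-- In a Hovey triple, `W` consists of the objects `X` fitting in a short exact sequence
`0 → X → V → G → 0` with `V ∈ W ∩ R` and `G ∈ Q ∩ W`. -/
theorem AbModel.IsHoveyTriple.eq_setOf_ses_left
    {A : Type*} [Category A] [Abelian A] {Q W R : Set A} (h : IsHoveyTriple Q W R) :
    W = {X | ∃ V G : A, V ∈ W ∩ R ∧ G ∈ Q ∩ W ∧ SES X V G} := by
  obtain ⟨⟨-, two_of_three⟩, -, -, -, enough⟩ := h
  ext X
  constructor
  · intro hX
    obtain ⟨G, V, hG, hV, hs⟩ := enough X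
    exact ⟨V, G, ⟨(two_of_three hs).2.1 hX hG.2, hV⟩, hG, hs⟩
  · rintro ⟨V, G, hV, hG, hs⟩
    exact (two_of_three hs).2.2 hV.1 hG.2

/-- In a Hovey triple, `W` consists of the objects `X` fitting in a short exact sequence
`0 → V → G → X → 0` with `V ∈ W ∩ R` and `G ∈ Q ∩ W`. -/
theorem AbModel.IsHoveyTriple.eq_setOf_ses_right
    {A : Type*} [Category A] [Abelian A] {Q W R : Set A} (h : IsHoveyTriple Q W R) :
    W = {X | ∃ V G : A, V ∈ W ∩ R ∧ G ∈ Q ∩ W ∧ SES V G X} := by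
  obtain ⟨⟨-, two_of_three⟩, ⟨-, enough, -⟩, -⟩ := h
  ext X
  constructor
  · intro hX
    obtain ⟨G, V, hG, hV, hs⟩ := enough X
    exact ⟨V, G, hV, ⟨hG, (two_of_three hs).2.1 hV.1 hX⟩, hs⟩
  · rintro ⟨V, G, hV, hG, hs⟩
    exact (two_of_three hs).1 hV.1 hG.2

/-- Proposition (characterization and uniqueness of the class of trivial objects of a
Hovey triple): if `(Q, W, R)` is a Hovey triple in an abelian category, then `W` is the
class of objects `X` admitting a short exact sequence `0 → X → V → G → 0` with
`V ∈ W ∩ R` and `G ∈ Q ∩ W`, and also the class of objects `X` admitting a short exact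
sequence `0 → V' → G' → X → 0` with `V' ∈ W ∩ R` and `G' ∈ Q ∩ W`.  Consequently, if
`(Q, V, R)` is any Hovey triple with the same `Q` and `R`, then `V = W`. -/
theorem trivial_class_characterization_and_uniqueness
    {A : Type*} [Category A] [Abelian A] {Q W R : Set A}
    (h : IsHoveyTriple Q W R) :
    W = {X | ∃ V G : A, V ∈ W ∩ R ∧ G ∈ Q ∩ W ∧ SES X V G} ∧
    W = {X | ∃ V G : A, V ∈ W ∩ R ∧ G ∈ Q ∩ W ∧ SES V G X} ∧
    (∀ V : Set A, IsHoveyTriple Q V R → V = W) := by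
  refine ⟨h.eq_setOf_ses_left, h.eq_setOf_ses_right, fun V hV => ?_⟩
  have right_eq : V ∩ R = W ∩ R := hV.2.1.1.2.trans h.2.1.1.2.symm
  have left_eq : Q ∩ V = Q ∩ W := hV.2.2.1.1.trans h.2.2.1.1.symm
  rw [hV.eq_setOf_ses_left, right_eq, left_eq, ← h.eq_setOf_ses_left]
end

section
/- Let R be a Gorenstein ring, i.e., R is left and right Noetherian and R has finite injective dimension both as a left R-module and as a right R-module. Let 𝒲 be the class of left R-modules of finite injective dimension (equivalently, of finite projective dimension), let 𝒢𝒫 = ^⊥𝒲 (the Gorenstein projective modules) and 𝒢ℐ = 𝒲^⊥ (the Gorenstein injective modules). Then: (1) 𝒲 is a thick class of left R-modules; (2) (𝒢𝒫, 𝒲) and (𝒲, 𝒢ℐ) are complete cotorsion pairs; (3) 𝒢𝒫 ∩ 𝒲 is exactly the class of projective left R-modules, and 𝒲 ∩ 𝒢ℐ is exactly the class of injective left R-modules. In other words, (𝒢𝒫, 𝒲, All) and (All, 𝒲, 𝒢ℐ) are Hovey triples in R-Mod. -/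
open CategoryTheory Limits ZeroObject

namespace AbModel

variable {A : Type*} [Category A] [Abelian A]

/-- `M` has injective dimension at most `n`: there is a finite injective coresolution
`0 → M → I⁰ → ⋯ → Iⁿ → 0`, expressed recursively. -/
def InjDimLE : ℕ → A → Prop
  | 0, M => Injective M
  | n + 1, M => ∃ I M' : A, Injective I ∧ SES M I M' ∧ InjDimLE n M'

/-- `M` has projective dimension at most `n`: there is a finite projective resolution
`0 → Pₙ → ⋯ → P₀ → M → 0`, expressed recursively. -/
def ProjDimLE : ℕ → A → Prop
  | 0, M => Projective M
  | n + 1, M => ∃ P M' : A, Projective P ∧ SES M' P M ∧ ProjDimLE n M'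

/-- `M` has finite injective dimension. -/
def HasFiniteInjDim (M : A) : Prop := ∃ n, InjDimLE n M

/-- `M` has finite projective dimension. -/
def HasFiniteProjDim (M : A) : Prop := ∃ n, ProjDimLE n M

end AbModel

open AbModel

namespace AbModel

universe u

section Abelian

variable {A : Type*} [Category A] [Abelian A]

lemma IsSES.ses {X Y Z : A} {f : X ⟶ Y} {g : Y ⟶ Z} (h : IsSES f g) : SES X Y Z := ⟨f, g, h⟩

lemma _root_.CategoryTheory.ShortComplex.ShortExact.ses {S : ShortComplex A}
    (h : S.ShortExact) : SES S.X₁ S.X₂ S.X₃ := ⟨S.f, S.g, S.zero, h⟩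

lemma IsSES.op {X Y Z : A} {f : X ⟶ Y} {g : Y ⟶ Z} (h : IsSES f g) : IsSES g.op f.op := by
  obtain ⟨w, h⟩ := h
  exact ⟨by rw [← op_comp, w, op_zero], h.op⟩

lemma SES.op {X Y Z : A} (h : SES X Y Z) :
    SES (Opposite.op Z) (Opposite.op Y) (Opposite.op X) := by
  obtain ⟨f, g, h⟩ := h
  exact ⟨g.op, f.op, h.op⟩

lemma SES.unop {X Y Z : Aᵒᵖ} (h : SES X Y Z) : SES Z.unop Y.unop X.unop := by
  obtain ⟨f, g, w, h⟩ := h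
  exact ⟨g.unop, f.unop, by rw [← unop_comp, w, unop_zero], h.unop⟩

lemma IsSES.of_isPushout_right {X Y Z D E : A} {f : X ⟶ Y} {g : Y ⟶ Z} (h : IsSES f g)
    {a : X ⟶ D} {r : Y ⟶ E} {b : D ⟶ E} (sq : IsPushout f a r b) : SES D E Z := by
  obtain ⟨w, h⟩ := h
  have := h.mono_f
  have := h.epi_g
  dsimp at *
  have hg : f ≫ g = a ≫ (0 : D ⟶ Z) := by simp [w]
  have hbm : Mono b := MorphismProperty.of_isPushout (P := .monomorphisms A) sq.flip ‹Mono f›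
  have he : Epi (sq.desc g 0 hg) := by
    have : Epi (r ≫ sq.desc g 0 hg) := by simpa
    exact epi_of_epi r _
  refine ⟨b, sq.desc g 0 hg, by simp, .mk' ?_ hbm he⟩
  refine ShortComplex.exact_of_g_is_cokernel _ (CokernelCofork.IsColimit.ofπ' _ _ fun k hk => ?_)
  have hk' : f ≫ r ≫ k = 0 := by rw [sq.w_assoc, hk, comp_zero]
  refine ⟨h.exact.desc (r ≫ k) hk', sq.hom_ext ?_ ?_⟩
  · simp only [IsPushout.inl_desc_assoc]
    exact h.exact.g_desc (r ≫ k) hk'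
  · simp [hk]

lemma IsSES.of_isPushout_left {L X Y D E : A} {f : X ⟶ Y} [Mono f]
    {l : L ⟶ X} {a : X ⟶ D} (h : IsSES l a) {r : Y ⟶ E} {b : D ⟶ E}
    (sq : IsPushout f a r b) : SES L Y E := by
  obtain ⟨w, h⟩ := h
  have := h.mono_f
  have := h.epi_g
  dsimp at *
  have he : Epi r := MorphismProperty.of_isPushout (P := .epimorphisms A) sq ‹Epi a›
  refine ⟨l ≫ f, r, by rw [Category.assoc, sq.w, reassoc_of% w, zero_comp],
    .mk' ?_ (mono_comp l f) he⟩
  refine ShortComplex.exact_of_g_is_cokernel _ (CokernelCofork.IsColimit.ofπ' _ _ fun k hk => ?_)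
  have hk' : l ≫ f ≫ k = 0 := by simpa using hk
  have hd : f ≫ k = a ≫ h.exact.desc (f ≫ k) hk' := (h.exact.g_desc (f ≫ k) hk').symm
  exact ⟨sq.desc k _ hd, by simp⟩

/-- `M` has a special left and a special right approximation by the pair `(G, W)`. -/
def Approximable (G W : Set A) (M : A) : Prop :=
  (∃ X ∈ G, ∃ Y ∈ W, SES Y X M) ∧ (∃ X ∈ G, ∃ Y ∈ W, SES M Y X)

section Approximable

variable {G W : Set A}

lemma exists_ses_right_of_left
    (hcoker : ∀ ⦃X Y Z : A⦄, SES X Y Z → X ∈ W → Y ∈ W → Z ∈ W)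
    (hemb : ∀ X ∈ G, ∃ P ∈ W, ∃ X' ∈ G, SES X P X')
    {M : A} (h : ∃ X ∈ G, ∃ Y ∈ W, SES Y X M) : ∃ X ∈ G, ∃ Y ∈ W, SES M Y X := by
  obtain ⟨X, hX, Y, hY, l, a, hla⟩ := h
  obtain ⟨P, hP, X', hX', f, g, hfg⟩ := hemb X hX
  have : Mono f := hfg.choose_spec.mono_f
  have sq := IsPushout.of_hasPushout f a
  exact ⟨X', hX', _, hcoker (hla.of_isPushout_left sq) hY hP, hfg.of_isPushout_right sq⟩

lemma Approximable.of_mem (hzero : ∀ Z : A, IsZero Z → Z ∈ W)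
    (hemb : ∀ X ∈ G, ∃ P ∈ W, ∃ X' ∈ G, SES X P X') {M : A} (hM : M ∈ G) :
    Approximable G W M := by
  constructor
  · refine ⟨M, hM, 0, hzero _ (isZero_zero A), 0, 𝟙 M, by simp, ?_⟩
    exact .mk' ((ShortComplex.exact_iff_mono _ rfl).2 inferInstance) inferInstance inferInstance
  · obtain ⟨P, hP, X', hX', h⟩ := hemb M hM
    exact ⟨X', hX', P, hP, h⟩

lemma Approximable.of_ses
    (hcoker : ∀ ⦃X Y Z : A⦄, SES X Y Z → X ∈ W → Y ∈ W → Z ∈ W)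
    (hext : ∀ ⦃X Y Z : A⦄, SES X Y Z → X ∈ G → Z ∈ G → Y ∈ G)
    (hemb : ∀ X ∈ G, ∃ P ∈ W, ∃ X' ∈ G, SES X P X')
    {M' P M : A} (h : SES M' P M) (hP : P ∈ G) (hM' : Approximable G W M') :
    Approximable G W M := by
  have hl : ∃ X ∈ G, ∃ Y ∈ W, SES Y X M := by
    obtain ⟨-, X, hX, Y, hY, a, b, hab⟩ := hM'
    obtain ⟨f, g, hfg⟩ := h
    have sq := IsPushout.of_hasPushout f a
    exact ⟨_, hext (hab.of_isPushout_right sq.flip) hP hX, Y, hY, hfg.of_isPushout_right sq⟩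
  exact ⟨hl, exists_ses_right_of_left hcoker hemb hl⟩

end Approximable

lemma Ext1IsZero.lift {X Y B C : A} (h : Ext1IsZero X Y) {i : Y ⟶ B} {p : B ⟶ C}
    (hip : IsSES i p) (f : X ⟶ C) : ∃ l : X ⟶ B, l ≫ p = f := by
  obtain ⟨w, hip⟩ := hip
  have := hip.mono_f
  have := hip.epi_g
  dsimp at *
  obtain ⟨j, hj₁, hj₂⟩ : ∃ j : Y ⟶ pullback p f,
      j ≫ pullback.fst p f = i ∧ j ≫ pullback.snd p f = 0 :=
    ⟨pullback.lift i 0 (by simp [w]), pullback.lift_fst _ _ _, pullback.lift_snd _ _ _⟩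
  have hmono : Mono j := by
    have : Mono (j ≫ pullback.fst p f) := by rwa [hj₁]
    exact mono_of_mono _ (pullback.fst p f)
  have hex : (ShortComplex.mk j (pullback.snd p f) hj₂).Exact :=
    ShortComplex.exact_of_f_is_kernel _ (KernelFork.IsLimit.ofι' _ _ fun k hk => by
      dsimp at hk
      have hk' : (k ≫ pullback.fst p f) ≫ p = 0 := by
        rw [Category.assoc, pullback.condition, ← Category.assoc, hk, zero_comp]
      refine ⟨hip.exact.lift (k ≫ pullback.fst p f) hk', pullback.hom_ext ?_ ?_⟩
      · dsimp
        rw [Category.assoc, hj₁]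
        exact hip.exact.lift_f (k ≫ pullback.fst p f) hk'
      · dsimp
        rw [Category.assoc, hj₂, hk, comp_zero])
  obtain ⟨s⟩ := h j (pullback.snd p f) hj₂ (.mk' hex hmono inferInstance)
  refine ⟨s.s ≫ pullback.fst p f, ?_⟩
  rw [Category.assoc, pullback.condition, ← Category.assoc]
  have := s.s_g
  dsimp at this
  rw [this, Category.id_comp]

lemma ext1IsZero_iff [HasExt A] [EnoughInjectives A] {X Y : A} :
    Ext1IsZero X Y ↔ Subsingleton (Abelian.Ext X Y 1) := by
  constructor
  · intro h
    refine subsingleton_of_forall_eq 0 fun x => ?_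
    have hS : (ShortComplex.mk (Injective.ι Y) (cokernel.π (Injective.ι Y)) (by simp)).ShortExact :=
      .mk' (ShortComplex.exact_of_g_is_cokernel _ (cokernelIsCokernel _)) inferInstance
        inferInstance
    obtain ⟨y, rfl⟩ := Abelian.Ext.covariant_sequence_exact₁ X hS x
      (Abelian.Ext.eq_zero_of_injective _) (n₀ := 0) rfl
    obtain ⟨g, rfl⟩ := Abelian.Ext.addEquiv₀.symm.surjective y
    obtain ⟨l, rfl⟩ := h.lift ⟨_, hS⟩ g
    rw [Abelian.Ext.addEquiv₀_symm_apply, ← Abelian.Ext.mk₀_comp_mk₀,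
      Abelian.Ext.comp_assoc_of_second_deg_zero]
    have := hS.comp_extClass
    dsimp at this
    rw [this, Abelian.Ext.comp_zero]
  · intro h Z f g w hS
    obtain ⟨s, hs⟩ := Abelian.Ext.covariant_sequence_exact₃ X hS (Abelian.Ext.mk₀ (𝟙 X))
      (n₁ := 1) rfl (Subsingleton.elim _ _)
    obtain ⟨s, rfl⟩ := Abelian.Ext.addEquiv₀.symm.surjective s
    dsimp at hs
    rw [Abelian.Ext.addEquiv₀_symm_apply, Abelian.Ext.mk₀_comp_mk₀] at hs
    have := hS.mono_f
    exact ⟨.ofExactOfSection _ hS.exact s ((Abelian.Ext.mk₀_bijective X X).1 hs) this⟩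

section Dimension

lemma injDimLE_iff [EnoughInjectives A] (n : ℕ) (M : A) :
    InjDimLE n M ↔ HasInjectiveDimensionLE M n := by
  induction n generalizing M with
  | zero => exact injective_iff_hasInjectiveDimensionLT_one
  | succ n ih =>
    constructor
    · rintro ⟨I, M', hI, ⟨f, g, w, hS⟩, hM'⟩
      exact (hS.hasInjectiveDimensionLT_X₃_iff n hI).1 ((ih _).1 hM')
    · intro h
      have hS : (ShortComplex.mk (Injective.ι M) (cokernel.π (Injective.ι M))
          (by simp)).ShortExact :=
        .mk' (ShortComplex.exact_of_g_is_cokernel _ (cokernelIsCokernel _)) inferInstance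
          inferInstance
      exact ⟨_, _, inferInstanceAs (Injective (Injective.under M)), ⟨_, _, _, hS⟩,
        (ih _).2 ((hS.hasInjectiveDimensionLT_X₃_iff n
          (inferInstanceAs (Injective (Injective.under M)))).2 h)⟩

lemma projDimLE_iff [EnoughProjectives A] (n : ℕ) (M : A) :
    ProjDimLE n M ↔ HasProjectiveDimensionLE M n := by
  induction n generalizing M with
  | zero => exact projective_iff_hasProjectiveDimensionLE_zero M
  | succ n ih =>
    constructor
    · rintro ⟨P, M', hP, ⟨f, g, w, hS⟩, hM'⟩
      exact (hS.hasProjectiveDimensionLT_X₃_iff n hP).2 ((ih _).1 hM')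
    · intro h
      have hS : (ShortComplex.mk (kernel.ι (Projective.π M)) (Projective.π M)
          (by simp)).ShortExact :=
        .mk' (ShortComplex.exact_of_f_is_kernel _ (kernelIsKernel _)) inferInstance
          inferInstance
      exact ⟨_, _, inferInstanceAs (Projective (Projective.over M)), ⟨_, _, _, hS⟩,
        (ih _).2 ((hS.hasProjectiveDimensionLT_X₃_iff n
          (inferInstanceAs (Projective (Projective.over M)))).1 h)⟩

end Dimension

end Abelian

section Assembly

variable {A : Type*} [Category A] [Abelian A]

lemma exists_ses_projective [EnoughProjectives A] (M : A) :
    ∃ K P : A, Projective P ∧ SES K P M :=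
  ⟨_, _, inferInstanceAs (Projective (Projective.over M)), kernel.ι (Projective.π M),
    Projective.π M, by simp,
    .mk' (ShortComplex.exact_of_f_is_kernel _ (kernelIsKernel _)) inferInstance inferInstance⟩

lemma exists_ses_injective [EnoughInjectives A] (M : A) :
    ∃ I K : A, Injective I ∧ SES M I K :=
  ⟨_, _, inferInstanceAs (Injective (Injective.under M)), Injective.ι M,
    cokernel.π (Injective.ι M), by simp,
    .mk' (ShortComplex.exact_of_g_is_cokernel _ (cokernelIsCokernel _)) inferInstance
      inferInstance⟩

lemma ext1IsZero_of_projective {P Y : A} (hP : Projective P) : Ext1IsZero P Y := by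
  intro Z f g w h
  have hm := h.mono_f
  have := h.epi_g
  exact ⟨.ofExactOfSection _ h.exact (Projective.factorThru (𝟙 P) g) (by simp) hm⟩

lemma ext1IsZero_of_injective {X I : A} (hI : Injective I) : Ext1IsZero X I := by
  intro Z f g w h
  have := h.mono_f
  have := h.epi_g
  exact ⟨.ofExactOfRetraction _ h.exact (Injective.factorThru (𝟙 I) f) (by simp) this⟩

lemma projective_of_ses {K P M : A} (hP : Projective P) (h : SES K P M) (hE : Ext1IsZero M K) :
    Projective M := by
  obtain ⟨f, g, w, h⟩ := h
  obtain ⟨s⟩ := hE f g w h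
  exact (Retract.mk s.s g s.s_g).projective

lemma injective_of_ses {M I K : A} (hI : Injective I) (h : SES M I K) (hE : Ext1IsZero K M) :
    Injective M := by
  obtain ⟨f, g, w, h⟩ := h
  obtain ⟨s⟩ := hE f g w h
  exact (Retract.mk f s.r s.f_r).injective

lemma isCompleteCotorsionPair_projective [EnoughProjectives A] :
    IsCompleteCotorsionPair {X : A | Projective X} Set.univ := by
  refine ⟨⟨?_, ?_⟩, ?_, ?_⟩
  · ext X
    refine ⟨fun h Y _ => ext1IsZero_of_projective h, fun h => ?_⟩
    obtain ⟨K, P, hP, hS⟩ := exists_ses_projective X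
    exact projective_of_ses hP hS (h K trivial)
  · exact (Set.eq_univ_of_forall fun Y X hX => ext1IsZero_of_projective hX).symm
  · intro M
    obtain ⟨K, P, hP, hS⟩ := exists_ses_projective M
    exact ⟨P, K, hP, trivial, hS⟩
  · intro M
    refine ⟨0, M, inferInstanceAs (Projective (0 : A)), trivial, 𝟙 M, 0, by simp, ?_⟩
    exact .mk' ((ShortComplex.exact_iff_epi _ rfl).2 inferInstance) inferInstance inferInstance

lemma isCompleteCotorsionPair_injective [EnoughInjectives A] :
    IsCompleteCotorsionPair Set.univ {X : A | Injective X} := by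
  refine ⟨⟨?_, ?_⟩, ?_, ?_⟩
  · exact (Set.eq_univ_of_forall fun Y X hX => ext1IsZero_of_injective hX).symm
  · ext X
    refine ⟨fun h Y _ => ext1IsZero_of_injective h, fun h => ?_⟩
    obtain ⟨I, K, hI, hS⟩ := exists_ses_injective X
    exact injective_of_ses hI hS (h K trivial)
  · intro M
    refine ⟨M, 0, trivial, inferInstanceAs (Injective (0 : A)), 0, 𝟙 M, by simp, ?_⟩
    exact .mk' ((ShortComplex.exact_iff_mono _ rfl).2 inferInstance) inferInstance inferInstance
  · intro M
    obtain ⟨I, K, hI, hS⟩ := exists_ses_injective M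
    exact ⟨K, I, trivial, hI, hS⟩

lemma hasFiniteInjDim_of_injective {M : A} (h : Injective M) : HasFiniteInjDim M := ⟨0, h⟩

lemma isCompleteCotorsionPair_leftPerp {W : Set A} (hW : IsThick W)
    (h : ∀ M, Approximable (leftPerp W) W M) : IsCompleteCotorsionPair (leftPerp W) W := by
  refine ⟨⟨rfl, Set.Subset.antisymm (fun Y hY X hX => hX Y hY) fun Y hY => ?_⟩,
    fun M => ?_, fun M => ?_⟩
  · obtain ⟨X, hX, V, hV, f, g, w, hS⟩ := (h Y).2
    obtain ⟨s⟩ := hY X hX f g w hS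
    exact hW.1 hV ⟨f, s.r, s.f_r⟩
  · obtain ⟨X, hX, V, hV, h⟩ := (h M).1
    exact ⟨X, V, hX, hV, h⟩
  · obtain ⟨X, hX, V, hV, h⟩ := (h M).2
    exact ⟨X, V, hX, hV, h⟩

lemma isCompleteCotorsionPair_rightPerp {W : Set A} (hW : IsThick W)
    (h : ∀ M : A, Approximable (A := Aᵒᵖ) {X | X.unop ∈ rightPerp W} {X | X.unop ∈ W}
      (Opposite.op M)) : IsCompleteCotorsionPair W (rightPerp W) := by
  refine ⟨⟨Set.Subset.antisymm (fun Y hY X hX => hX Y hY) fun Y hY => ?_, rfl⟩,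
    fun M => ?_, fun M => ?_⟩
  · obtain ⟨X, hX, V, hV, h⟩ := (h Y).2
    obtain ⟨f, g, w, hS⟩ := h.unop
    obtain ⟨s⟩ := hY X.unop hX f g w hS
    exact hW.1 hV ⟨s.s, g, s.s_g⟩
  · obtain ⟨X, hX, V, hV, h⟩ := (h M).2
    exact ⟨V.unop, X.unop, hV, hX, h.unop⟩
  · obtain ⟨X, hX, V, hV, h⟩ := (h M).1
    exact ⟨V.unop, X.unop, hV, hX, h.unop⟩

lemma hasFiniteInjDim_iff [EnoughInjectives A] {M : A} :
    HasFiniteInjDim M ↔ ∃ n, HasInjectiveDimensionLE M n := by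
  simp only [HasFiniteInjDim, injDimLE_iff]

lemma isThick_hasFiniteInjDim [EnoughInjectives A] : IsThick {M : A | HasFiniteInjDim M} := by
  refine ⟨?_, ?_⟩
  · rintro X Y hY ⟨i, r, hir⟩
    obtain ⟨n, hn⟩ := hasFiniteInjDim_iff.1 hY
    refine hasFiniteInjDim_iff.2 ⟨n, ?_⟩
    rw [← injectiveDimension_le_iff] at hn ⊢
    exact (Retract.mk i r hir).injectiveDimension_le.trans hn
  · rintro X Y Z ⟨f, g, w, hS⟩
    have mono : ∀ {M : A} {m n : ℕ}, m ≤ n → HasInjectiveDimensionLE M m →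
        HasInjectiveDimensionLT M n.succ := fun hmn h =>
      hasInjectiveDimensionLT_of_ge _ _ _ (Nat.succ_le_succ hmn)
    simp only [Set.mem_ofPred_eq, hasFiniteInjDim_iff]
    refine ⟨?_, ?_, ?_⟩
    · rintro ⟨a, ha⟩ ⟨b, hb⟩
      exact ⟨a + b, hS.hasInjectiveDimensionLT_X₃ _ (mono (by lia) hb) (mono (by lia) ha)⟩
    · rintro ⟨a, ha⟩ ⟨b, hb⟩
      exact ⟨a + b, hS.hasInjectiveDimensionLT_X₂ _ (mono (by lia) ha) (mono (by lia) hb)⟩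
    · rintro ⟨a, ha⟩ ⟨b, hb⟩
      exact ⟨a + b + 1, hS.hasInjectiveDimensionLT_X₁ _ (mono (by lia) hb) (mono (by lia) ha)⟩

variable [HasExt A]

lemma subsingleton_ext_of_exact₂ {S : ShortComplex A} (hS : S.ShortExact) (Y : A) (n : ℕ)
    (h₁ : Subsingleton (Abelian.Ext S.X₁ Y n)) (h₃ : Subsingleton (Abelian.Ext S.X₃ Y n)) :
    Subsingleton (Abelian.Ext S.X₂ Y n) := by
  refine subsingleton_of_forall_eq 0 fun x => ?_
  obtain ⟨y, rfl⟩ := Abelian.Ext.contravariant_sequence_exact₂ hS Y x (Subsingleton.elim _ _)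
  rw [Subsingleton.elim y 0, Abelian.Ext.comp_zero]

lemma subsingleton_ext_of_exact₂' {S : ShortComplex A} (hS : S.ShortExact) (X : A) (n : ℕ)
    (h₁ : Subsingleton (Abelian.Ext X S.X₁ n)) (h₃ : Subsingleton (Abelian.Ext X S.X₃ n)) :
    Subsingleton (Abelian.Ext X S.X₂ n) := by
  refine subsingleton_of_forall_eq 0 fun x => ?_
  obtain ⟨y, rfl⟩ := Abelian.Ext.covariant_sequence_exact₂ X hS x (Subsingleton.elim _ _)
  rw [Subsingleton.elim y 0, Abelian.Ext.zero_comp]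

lemma subsingleton_ext_syzygy {S : ShortComplex A} (hS : S.ShortExact) (hP : Projective S.X₂)
    (Y : A) (n : ℕ) :
    Subsingleton (Abelian.Ext S.X₁ Y (n + 1)) ↔ Subsingleton (Abelian.Ext S.X₃ Y (n + 2)) := by
  constructor <;> intro h <;> refine subsingleton_of_forall_eq 0 fun x => ?_
  · obtain ⟨y, rfl⟩ := Abelian.Ext.contravariant_sequence_exact₃ hS Y x
      (Abelian.Ext.eq_zero_of_projective _) (n₀ := n + 1) (by lia)
    rw [Subsingleton.elim y 0, Abelian.Ext.comp_zero]
  · obtain ⟨y, rfl⟩ := Abelian.Ext.contravariant_sequence_exact₁ hS Y x (n₁ := n + 2) (by lia)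
      (Subsingleton.elim _ _)
    rw [Abelian.Ext.eq_zero_of_projective y, Abelian.Ext.comp_zero]

lemma subsingleton_ext_cosyzygy {S : ShortComplex A} (hS : S.ShortExact) (hI : Injective S.X₂)
    (X : A) (n : ℕ) :
    Subsingleton (Abelian.Ext X S.X₃ (n + 1)) ↔ Subsingleton (Abelian.Ext X S.X₁ (n + 2)) := by
  constructor <;> intro h <;> refine subsingleton_of_forall_eq 0 fun x => ?_
  · obtain ⟨y, rfl⟩ := Abelian.Ext.covariant_sequence_exact₁ X hS x
      (Abelian.Ext.eq_zero_of_injective _) (n₀ := n + 1) (by lia)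
    rw [Subsingleton.elim y 0, Abelian.Ext.zero_comp]
  · obtain ⟨y, rfl⟩ := Abelian.Ext.covariant_sequence_exact₃ X hS x (n₁ := n + 2) (by lia)
      (Subsingleton.elim _ _)
    rw [Abelian.Ext.eq_zero_of_injective y, Abelian.Ext.zero_comp]

variable [EnoughInjectives A]

lemma approximable_op_of_subsingleton_ext {W : Set A} (hW : IsThick W)
    (hzero : ∀ Z : A, IsZero Z → Z ∈ W)
    (hemb : ∀ X ∈ rightPerp W, ∃ P ∈ W, ∃ X' ∈ rightPerp W, SES X' P X)
    (n : ℕ) (M : A) (hM : ∀ Y ∈ W, Subsingleton (Abelian.Ext Y M (n + 1))) :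
    Approximable (A := Aᵒᵖ) {X | X.unop ∈ rightPerp W} {X | X.unop ∈ W} (Opposite.op M) := by
  have hemb' : ∀ X ∈ {X : Aᵒᵖ | X.unop ∈ rightPerp W}, ∃ P ∈ {X : Aᵒᵖ | X.unop ∈ W},
      ∃ X' ∈ {X : Aᵒᵖ | X.unop ∈ rightPerp W}, SES X P X' := fun X hX => by
    obtain ⟨P, hP, X', hX', h⟩ := hemb _ hX
    exact ⟨_, hP, _, hX', h.op⟩
  induction n generalizing M with
  | zero =>
    exact .of_mem (A := Aᵒᵖ) (G := {X | X.unop ∈ rightPerp W}) (W := {X | X.unop ∈ W})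
      (fun Z h => hzero _ h.unop) hemb' (fun Y hY => ext1IsZero_iff.2 (hM Y hY))
  | succ n ih =>
    obtain ⟨I, K, hI, f, g, w, hS⟩ := exists_ses_injective M
    refine .of_ses (A := Aᵒᵖ) (G := {X | X.unop ∈ rightPerp W}) (W := {X | X.unop ∈ W})
      (fun X Y Z h hX hY => (hW.2 h.unop).2.2 hY hX)
      (fun X Y Z h hX hZ V hV => ?_) hemb' (SES.op ⟨f, g, w, hS⟩)
      (fun Y _ => ext1IsZero_of_injective hI)
      (ih K fun Y hY => (subsingleton_ext_cosyzygy hS hI Y n).2 (hM Y hY))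
    obtain ⟨f, g, w, h⟩ := h.unop
    exact ext1IsZero_iff.2 (subsingleton_ext_of_exact₂' h V 1 (ext1IsZero_iff.1 (hZ V hV))
      (ext1IsZero_iff.1 (hX V hV)))

variable [EnoughProjectives A]

lemma approximable_of_subsingleton_ext {W : Set A} (hW : IsThick W)
    (hzero : ∀ Z : A, IsZero Z → Z ∈ W)
    (hemb : ∀ X ∈ leftPerp W, ∃ P ∈ W, ∃ X' ∈ leftPerp W, SES X P X')
    (n : ℕ) (M : A) (hM : ∀ Y ∈ W, Subsingleton (Abelian.Ext M Y (n + 1))) :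
    Approximable (leftPerp W) W M := by
  induction n generalizing M with
  | zero => exact .of_mem hzero hemb fun Y hY => ext1IsZero_iff.2 (hM Y hY)
  | succ n ih =>
    obtain ⟨K, P, hP, f, g, w, hS⟩ := exists_ses_projective M
    refine .of_ses (G := leftPerp W) (fun X Y Z h => (hW.2 h).1) (fun X Y Z h hX hZ V hV => ?_)
      hemb ⟨f, g, w, hS⟩ (fun Y _ => ext1IsZero_of_projective hP)
      (ih K fun Y hY => (subsingleton_ext_syzygy hS hP Y n).2 (hM Y hY))
    obtain ⟨f, g, w, h⟩ := h
    exact ext1IsZero_iff.2 (subsingleton_ext_of_exact₂ h V 1 (ext1IsZero_iff.1 (hX V hV))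
      (ext1IsZero_iff.1 (hZ V hV)))

/-- Given uniform bounds on the dimensions of the objects of finite injective dimension, and
embeddings of Gorenstein projectives into projectives (and dually), the Gorenstein model
structures exist. -/
theorem hovey_triples_of_bounds (N : ℕ)
    (hinj : ∀ M : A, HasFiniteInjDim M → HasInjectiveDimensionLE M N)
    (hproj : ∀ M : A, HasFiniteInjDim M → HasProjectiveDimensionLE M N)
    (hfin : ∀ M : A, HasFiniteProjDim M → HasFiniteInjDim M)
    (hGP : ∀ X ∈ leftPerp {M : A | HasFiniteInjDim M},
      ∃ P : A, Projective P ∧ ∃ X' ∈ leftPerp {M : A | HasFiniteInjDim M}, SES X P X')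
    (hGI : ∀ X ∈ rightPerp {M : A | HasFiniteInjDim M},
      ∃ I : A, Injective I ∧ ∃ X' ∈ rightPerp {M : A | HasFiniteInjDim M}, SES X' I X) :
    (∀ M : A, HasFiniteInjDim M ↔ HasFiniteProjDim M) ∧
    IsThick {M : A | HasFiniteInjDim M} ∧
    IsCompleteCotorsionPair (leftPerp {M : A | HasFiniteInjDim M}) {M : A | HasFiniteInjDim M} ∧
    IsCompleteCotorsionPair {M : A | HasFiniteInjDim M} (rightPerp {M : A | HasFiniteInjDim M}) ∧
    leftPerp {M : A | HasFiniteInjDim M} ∩ {M : A | HasFiniteInjDim M} =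
      {M : A | Projective M} ∧
    {M : A | HasFiniteInjDim M} ∩ rightPerp {M : A | HasFiniteInjDim M} =
      {M : A | Injective M} ∧
    IsHoveyTriple (leftPerp {M : A | HasFiniteInjDim M}) {M : A | HasFiniteInjDim M} Set.univ ∧
    IsHoveyTriple Set.univ {M : A | HasFiniteInjDim M}
      (rightPerp {M : A | HasFiniteInjDim M}) := by
  have hP : ∀ P : A, Projective P → HasFiniteInjDim P := fun P h => hfin P ⟨0, h⟩
  have hthick := isThick_hasFiniteInjDim (A := A)
  have hzero : ∀ Z : A, IsZero Z → Z ∈ {M : A | HasFiniteInjDim M} := fun Z h =>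
    hasFiniteInjDim_of_injective h.injective
  have hleft : IsCompleteCotorsionPair (leftPerp {M : A | HasFiniteInjDim M})
      {M : A | HasFiniteInjDim M} := by
    refine isCompleteCotorsionPair_leftPerp hthick fun M =>
      approximable_of_subsingleton_ext hthick hzero (fun X hX => ?_) N M fun Y hY => ?_
    · obtain ⟨P, hP', h⟩ := hGP X hX
      exact ⟨P, hP P hP', h⟩
    · have := hinj Y hY
      exact HasInjectiveDimensionLT.subsingleton Y (N + 1) (N + 1) le_rfl M
  have hright : IsCompleteCotorsionPair {M : A | HasFiniteInjDim M}
      (rightPerp {M : A | HasFiniteInjDim M}) := by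
    refine isCompleteCotorsionPair_rightPerp hthick fun M =>
      approximable_op_of_subsingleton_ext hthick hzero (fun X hX => ?_) N M fun Y hY => ?_
    · obtain ⟨I, hI, h⟩ := hGI X hX
      exact ⟨I, hasFiniteInjDim_of_injective hI, h⟩
    · have := hproj Y hY
      exact HasProjectiveDimensionLT.subsingleton Y (N + 1) (N + 1) le_rfl M
  have hproj_eq : leftPerp {M : A | HasFiniteInjDim M} ∩ {M : A | HasFiniteInjDim M} =
      {M : A | Projective M} := by
    refine Set.Subset.antisymm ?_ fun P h => ⟨fun Y _ => ext1IsZero_of_projective h, hP P h⟩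
    rintro X ⟨hX, hXW⟩
    obtain ⟨K, P, hP', hS⟩ := exists_ses_projective X
    exact projective_of_ses hP' hS (hX K ((hthick.2 hS).2.2 (hP P hP') hXW))
  have hinj_eq : {M : A | HasFiniteInjDim M} ∩ rightPerp {M : A | HasFiniteInjDim M} =
      {M : A | Injective M} := by
    refine Set.Subset.antisymm ?_ fun I h =>
      ⟨hasFiniteInjDim_of_injective h, fun Y _ => ext1IsZero_of_injective h⟩
    rintro X ⟨hXW, hX⟩
    obtain ⟨I, K, hI, hS⟩ := exists_ses_injective X
    exact injective_of_ses hI hS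
      (hX K ((hthick.2 hS).1 hXW (hasFiniteInjDim_of_injective hI)))
  refine ⟨fun M => ⟨fun h => ⟨N, (projDimLE_iff N M).2 (hproj M h)⟩, hfin M⟩, hthick, hleft,
    hright, hproj_eq, hinj_eq, ⟨hthick, ?_, ?_⟩, ⟨hthick, ?_, ?_⟩⟩
  · rwa [Set.inter_univ]
  · rw [hproj_eq]
    exact isCompleteCotorsionPair_projective
  · rw [hinj_eq]
    exact isCompleteCotorsionPair_injective
  · rwa [Set.univ_inter]

end Assembly

section ExtOne

variable {A : Type*} [Category A] [Abelian A] [HasExt A] {S : ShortComplex A}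

lemma exists_extension_of_subsingleton_ext (hS : S.ShortExact) {Y : A}
    (h : Subsingleton (Abelian.Ext S.X₃ Y 1)) (f : S.X₁ ⟶ Y) : ∃ g : S.X₂ ⟶ Y, S.f ≫ g = f := by
  obtain ⟨x, hx⟩ := Abelian.Ext.contravariant_sequence_exact₁ hS Y (Abelian.Ext.mk₀ f)
    (n₁ := 1) rfl (Subsingleton.elim _ _)
  obtain ⟨g, rfl⟩ := (Abelian.Ext.mk₀_bijective _ _).2 x
  exact ⟨g, (Abelian.Ext.mk₀_bijective _ _).1 (by rw [← Abelian.Ext.mk₀_comp_mk₀, hx])⟩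

lemma subsingleton_ext_of_exists_extension (hS : S.ShortExact) {Y : A}
    (h₂ : Subsingleton (Abelian.Ext S.X₂ Y 1))
    (h : ∀ f : S.X₁ ⟶ Y, ∃ g : S.X₂ ⟶ Y, S.f ≫ g = f) :
    Subsingleton (Abelian.Ext S.X₃ Y 1) := by
  refine subsingleton_of_forall_eq 0 fun x => ?_
  obtain ⟨y, rfl⟩ := Abelian.Ext.contravariant_sequence_exact₃ hS Y x (Subsingleton.elim _ _)
    (n₀ := 0) rfl
  obtain ⟨f, rfl⟩ := (Abelian.Ext.mk₀_bijective _ _).2 y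
  obtain ⟨g, rfl⟩ := h f
  rw [← Abelian.Ext.mk₀_comp_mk₀]
  have := hS.extClass_comp
  rw [← Abelian.Ext.comp_assoc_of_third_deg_zero, this, Abelian.Ext.zero_comp]

lemma subsingleton_ext_of_exists_lift (hS : S.ShortExact) {X : A}
    (h₂ : Subsingleton (Abelian.Ext X S.X₂ 1))
    (h : ∀ f : X ⟶ S.X₃, ∃ g : X ⟶ S.X₂, g ≫ S.g = f) :
    Subsingleton (Abelian.Ext X S.X₁ 1) := by
  refine subsingleton_of_forall_eq 0 fun x => ?_
  obtain ⟨y, rfl⟩ := Abelian.Ext.covariant_sequence_exact₁ X hS x (Subsingleton.elim _ _)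
    (n₀ := 0) rfl
  obtain ⟨f, rfl⟩ := (Abelian.Ext.mk₀_bijective _ _).2 y
  obtain ⟨g, rfl⟩ := h f
  rw [← Abelian.Ext.mk₀_comp_mk₀, Abelian.Ext.comp_assoc_of_second_deg_zero, hS.comp_extClass,
    Abelian.Ext.comp_zero]

end ExtOne

section Modules

variable {R : Type u} [Ring R]

lemma shortExact_subtype {M : Type u} [AddCommGroup M] [Module R M] (N : Submodule R M) :
    (ShortComplex.mk (ModuleCat.ofHom N.subtype) (ModuleCat.ofHom N.mkQ)
      (by ext; simp)).ShortExact :=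
  ModuleCat.shortComplex_shortExact _ (LinearMap.exact_subtype_mkQ N) N.injective_subtype
    N.mkQ_surjective

lemma injective_of_subsingleton_ext (M : ModuleCat.{u} R)
    (h : ∀ J : Ideal R, Subsingleton (Abelian.Ext (ModuleCat.of R (R ⧸ J)) M 1)) :
    Injective M := by
  refine (Module.injective_iff_injective_object R M).1 (Module.Baer.injective fun J g => ?_)
  obtain ⟨k, hk⟩ := exists_extension_of_subsingleton_ext (shortExact_subtype (R := R) J) (h J)
    (ModuleCat.ofHom g)
  refine ⟨k.hom, fun x hx => ?_⟩
  have := congr(($hk).hom ⟨x, hx⟩)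
  exact this

lemma hasInjectiveDimensionLE_of_subsingleton_ext (n : ℕ) (M : ModuleCat.{u} R)
    (h : ∀ J : Ideal R, Subsingleton (Abelian.Ext (ModuleCat.of R (R ⧸ J)) M (n + 1))) :
    HasInjectiveDimensionLE M n := by
  induction n generalizing M with
  | zero => exact injective_iff_hasInjectiveDimensionLT_one.1 (injective_of_subsingleton_ext M h)
  | succ n ih =>
    obtain ⟨I, K, hI, f, g, w, hS⟩ := exists_ses_injective M
    exact (hS.hasInjectiveDimensionLT_X₃_iff n hI).1
      (ih K fun J => (subsingleton_ext_cosyzygy hS hI _ n).2 (h J))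

end Modules

section SmulVec

variable {R : Type u} [Ring R] {M M' : Type*} [AddCommGroup M] [Module R M] [AddCommGroup M']
  [Module R M'] {l m n : Type*} [Fintype n]

/-- The action of a matrix over `R` on a vector with entries in a left `R`-module. -/
def smulVec (A : Matrix m n R) (x : n → M) : m → M := fun i => ∑ j, A i j • x j

lemma smulVec_sub (A : Matrix m n R) (x y : n → M) :
    smulVec A (x - y) = smulVec A x - smulVec A y := by
  ext i
  simp [smulVec, smul_sub]

lemma smulVec_mul [Fintype m] (A : Matrix l m R) (B : Matrix m n R) (x : n → M) :
    smulVec (A * B) x = smulVec A (smulVec B x) := by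
  ext i
  simp only [smulVec, Matrix.mul_apply, Finset.sum_smul, Finset.smul_sum, mul_smul]
  exact Finset.sum_comm

lemma smulVec_zero (x : n → M) : smulVec (0 : Matrix m n R) x = 0 := by
  ext i
  simp [smulVec]

lemma map_smulVec (f : M →ₗ[R] M') (A : Matrix m n R) (x : n → M) :
    f ∘ smulVec A x = smulVec A (f ∘ x) := by
  ext i
  simp [smulVec]

end SmulVec

/-- An exact complex of finite free right `R`-modules, unbounded to the left. -/
structure MatrixResolution (R : Type u) [Ring R] where
  rank : ℕ → ℕ
  mat (i : ℕ) : Matrix (Fin (rank i)) (Fin (rank (i + 1))) R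
  mul_eq_zero (i : ℕ) : mat i * mat (i + 1) = 0
  exact (i : ℕ) (v : Fin (rank (i + 1)) → R) (hv : smulVec (mat i) v = 0) :
    ∃ w, v = smulVec (mat (i + 1)) w

namespace MatrixResolution

variable {R : Type u} [Ring R]

/-- Drop the last term of the complex. -/
def shift (C : MatrixResolution R) : MatrixResolution R where
  rank i := C.rank (i + 1)
  mat i := C.mat (i + 1)
  mul_eq_zero i := C.mul_eq_zero (i + 1)
  exact i := C.exact (i + 1)

/-- Exactness, in degree `i + 1`, of the tensor product of the complex with `M`. -/
def ExactAt (C : MatrixResolution R) (M : Type*) [AddCommGroup M] [Module R M] (i : ℕ) : Prop :=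
  ∀ x : Fin (C.rank (i + 1)) → M, smulVec (C.mat i) x = 0 → ∃ y, x = smulVec (C.mat (i + 1)) y

end MatrixResolution

/-- `M` has flat dimension at most `n` (tested on resolutions by finite free right modules). -/
def FlatDimLE (R : Type u) [Ring R] (n : ℕ) (M : Type*) [AddCommGroup M] [Module R M] : Prop :=
  ∀ C : MatrixResolution R, C.ExactAt M n

section FlatDim

variable {R : Type u} [Ring R]

lemma FlatDimLE.succ {n : ℕ} {M : Type*} [AddCommGroup M] [Module R M] (h : FlatDimLE R n M) :
    FlatDimLE R (n + 1) M := fun C => h C.shift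

lemma FlatDimLE.pi {n : ℕ} {ι : Type*} {M : ι → Type*} [∀ i, AddCommGroup (M i)]
    [∀ i, Module R (M i)] (h : ∀ i, FlatDimLE R n (M i)) : FlatDimLE R n (∀ i, M i) := by
  intro C x hx
  have key (t : ι) : ∃ y, (fun j => x j t) = smulVec (C.mat (n + 1)) y := by
    refine h t C _ ?_
    have := map_smulVec (LinearMap.proj (R := R) (φ := M) t) (C.mat n) x
    rw [hx] at this
    exact this.symm
  choose y hy using key
  refine ⟨fun j t => y t j, ?_⟩
  ext j t
  have := congrFun (hy t) j
  simp only [smulVec] at this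
  simp [smulVec, this]

lemma flatDimLE_of_projective {M : Type*} [AddCommGroup M] [Module R M] [Module.Projective R M] :
    FlatDimLE R 0 M := by
  intro C x hx
  obtain ⟨s, hs⟩ := (Module.projective_def' (R := R) (P := M)).1 inferInstance
  have key (t : M) : ∃ y, (fun j => s (x j) t) = smulVec (C.mat (0 + 1)) y ∧
      ((∀ j, s (x j) t = 0) → y = 0) := by
    by_cases ht : ∀ j, s (x j) t = 0
    · exact ⟨0, by ext j; simp [smulVec, ht j], fun _ => rfl⟩
    · obtain ⟨y, hy⟩ := C.exact 0 (fun j => s (x j) t) (by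
        have := map_smulVec (Finsupp.lapply t ∘ₗ s) (C.mat 0) x
        rw [hx] at this
        exact this.symm.trans (by ext; simp))
      exact ⟨y, hy, fun h => absurd h ht⟩
  classical
  choose y hy hy₀ using key
  let Y (j : Fin (C.rank (0 + 1 + 1))) : M →₀ R := Finsupp.onFinset
    (Finset.univ.biUnion fun j => (s (x j)).support) (fun t => y t j) (fun t ht => by
      by_contra hn
      simp only [Finset.mem_biUnion, Finset.mem_univ, true_and, Finsupp.mem_support_iff,
        not_exists, not_not] at hn
      exact ht (by simp [hy₀ t hn]))
  have hY : s ∘ x = smulVec (C.mat (0 + 1)) Y := by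
    ext j t
    have := congrFun (hy t) j
    simp only [smulVec] at this
    simp [smulVec, this, Y]
  refine ⟨Finsupp.linearCombination R id ∘ Y, ?_⟩
  rw [← map_smulVec, ← hY]
  ext j
  exact (LinearMap.congr_fun hs (x j)).symm

lemma FlatDimLE.of_exact {K P M : Type*} [AddCommGroup K] [Module R K] [AddCommGroup P]
    [Module R P] [AddCommGroup M] [Module R M] [Module.Projective R P] {f : K →ₗ[R] P}
    {g : P →ₗ[R] M} (hf : Function.Injective f) (hg : Function.Surjective g)
    (hfg : Function.Exact f g) {n : ℕ} (h : FlatDimLE R (n + 1) M) : FlatDimLE R n K := by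
  intro C x hx
  have hP : C.ExactAt P n := by
    have (n : ℕ) : FlatDimLE R n P := by
      induction n with
      | zero => exact flatDimLE_of_projective
      | succ n ih => exact ih.succ
    exact this n C
  obtain ⟨y, hy⟩ := hP (f ∘ x) (by rw [← map_smulVec, hx]; ext; simp)
  obtain ⟨z, hz⟩ := h C (g ∘ y) (by
    rw [← map_smulVec, ← hy]
    ext j
    exact hfg.apply_apply_eq_zero (x j))
  choose z' hz' using fun j => hg (z j)
  obtain rfl : g ∘ z' = z := funext hz'
  have hk (j) : ∃ k, f k = (y - smulVec (C.mat (n + 2)) z') j := by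
    refine (hfg _).1 ?_
    rw [← map_smulVec] at hz
    simpa [sub_eq_zero] using congrFun hz j
  choose k hk using hk
  refine ⟨k, funext fun j => hf ?_⟩
  have h1 := congrFun (map_smulVec f (C.mat (n + 1)) k) j
  have h2 : f ∘ k = y - smulVec (C.mat (n + 2)) z' := funext hk
  rw [h2, smulVec_sub, ← smulVec_mul, C.mul_eq_zero, smulVec_zero, sub_zero, ← hy] at h1
  exact h1.symm

end FlatDim

lemma exists_factorization_of_injDimLE {A : Type*} [Category A] [Abelian A] {P : ℕ → A}
    (hP : ∀ i, Projective (P i)) (d : ∀ i, P (i + 1) ⟶ P i) (hd : ∀ i, d (i + 1) ≫ d i = 0)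
    (hex : ∀ i, (ShortComplex.mk _ _ (hd i)).Exact) (n : ℕ) (E : A) (hE : InjDimLE n E)
    (i : ℕ) (hi : n ≤ i) (g : P (i + 1) ⟶ E) (hg : d (i + 1) ≫ g = 0) : ∃ h, d i ≫ h = g := by
  induction n generalizing E i with
  | zero =>
    have : Injective E := hE
    exact ⟨(hex i).descToInjective g hg, (hex i).comp_descToInjective g hg⟩
  | succ n ih =>
    obtain ⟨I, E', hI, ⟨a, b, w, hS⟩, hE'⟩ := hE
    have := hS.epi_g
    have hm := hS.mono_f
    dsimp at this hm
    obtain ⟨i, rfl⟩ : ∃ j, i = j + 1 := ⟨i - 1, by lia⟩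
    have h₀ : d (i + 1 + 1) ≫ g ≫ a = 0 := by rw [reassoc_of% hg, zero_comp]
    let h := (hex (i + 1)).descToInjective (g ≫ a) h₀
    have hh : d (i + 1) ≫ h = g ≫ a := (hex (i + 1)).comp_descToInjective (g ≫ a) h₀
    obtain ⟨k, hk⟩ := ih E' hE' i (by lia) (h ≫ b) (by rw [reassoc_of% hh, w, comp_zero])
    have := hP i
    let k' := Projective.factorThru k b
    have hk' : k' ≫ b = k := Projective.factorThru_comp _ _
    have h₁ : (h - d i ≫ k') ≫ b = 0 := by simp [hk', hk]
    refine ⟨hS.exact.lift (h - d i ≫ k') h₁, ?_⟩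
    rw [← cancel_mono a, Category.assoc]
    have := hS.exact.lift_f (h - d i ≫ k') h₁
    dsimp at this
    rw [this, Preadditive.comp_sub, reassoc_of% (hd i), zero_comp, sub_zero, hh]

namespace MatrixResolution

variable {R : Type u} [Ring R]

/-- The differential of the complex, as a map of modules over the opposite ring. -/
def d (C : MatrixResolution R) (i : ℕ) :
    ModuleCat.of Rᵐᵒᵖ (Fin (C.rank (i + 1)) → Rᵐᵒᵖ) ⟶
      ModuleCat.of Rᵐᵒᵖ (Fin (C.rank i) → Rᵐᵒᵖ) :=
  ModuleCat.ofHom (Matrix.toLinearMapRight' ((C.mat i).transpose.map MulOpposite.op))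

lemma d_apply (C : MatrixResolution R) (i : ℕ) (v : Fin (C.rank (i + 1)) → Rᵐᵒᵖ) :
    (C.d i).hom v = MulOpposite.op ∘ smulVec (C.mat i) (MulOpposite.unop ∘ v) := by
  ext j
  simp [d, smulVec, Matrix.vecMul, dotProduct]

lemma d_comp_d (C : MatrixResolution R) (i : ℕ) : C.d (i + 1) ≫ C.d i = 0 := by
  refine ModuleCat.hom_ext (LinearMap.ext fun v => ?_)
  rw [ModuleCat.hom_comp, LinearMap.comp_apply, d_apply, d_apply]
  have h : (MulOpposite.unop : Rᵐᵒᵖ → R) ∘ MulOpposite.op ∘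
      smulVec (C.mat (i + 1)) (MulOpposite.unop ∘ v) =
        smulVec (C.mat (i + 1)) (MulOpposite.unop ∘ v) := rfl
  rw [h, ← smulVec_mul, C.mul_eq_zero, smulVec_zero]
  rfl

lemma d_exact (C : MatrixResolution R) (i : ℕ) :
    (ShortComplex.mk _ _ (C.d_comp_d i)).Exact := by
  rw [ShortComplex.moduleCat_exact_iff]
  intro v hv
  change (C.d i).hom v = 0 at hv
  rw [d_apply] at hv
  obtain ⟨w, hw⟩ := C.exact i (MulOpposite.unop ∘ v)
    (funext fun j => MulOpposite.op_injective (congrFun hv j))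
  refine ⟨MulOpposite.op ∘ w, ?_⟩
  change (C.d (i + 1)).hom _ = v
  rw [d_apply]
  exact funext fun j => congrArg MulOpposite.op (congrFun hw j).symm

lemma exists_vecMul_eq (C : MatrixResolution R) {n : ℕ}
    (hr : InjDimLE n (ModuleCat.of Rᵐᵒᵖ Rᵐᵒᵖ)) {i : ℕ} (hi : n ≤ i)
    (v : Fin (C.rank (i + 1)) → R) (hv : Matrix.vecMul v (C.mat (i + 1)) = 0) :
    ∃ w, Matrix.vecMul w (C.mat i) = v := by
  obtain ⟨h, hh⟩ := exists_factorization_of_injDimLE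
    (P := fun i => ModuleCat.of Rᵐᵒᵖ (Fin (C.rank i) → Rᵐᵒᵖ))
    (fun i => ModuleCat.projective_of_free (Pi.basisFun Rᵐᵒᵖ (Fin (C.rank i))))
    C.d C.d_comp_d C.d_exact n _ hr i hi
    (ModuleCat.ofHom (Fintype.linearCombination Rᵐᵒᵖ (MulOpposite.op ∘ v)))
    (by
      refine ModuleCat.hom_ext (LinearMap.pi_ext' fun j => LinearMap.ext_ring ?_)
      have := congrArg MulOpposite.op (congrFun hv j)
      simpa [d, Fintype.linearCombination_apply, Matrix.vecMul, dotProduct] using this)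
  refine ⟨fun k => (h.hom (Pi.single k 1)).unop, funext fun j => ?_⟩
  have h1 := congrArg MulOpposite.unop congr(($hh).hom (Pi.single j 1))
  have h2 : (C.d i).hom (Pi.single j 1) =
      ∑ k, MulOpposite.op (C.mat i k j) • Pi.single k (1 : Rᵐᵒᵖ) := by
    ext k
    simp [d, Finset.sum_apply, Pi.single_apply]
  simp only [ModuleCat.hom_comp, LinearMap.comp_apply, h2, map_sum, map_smul] at h1
  simpa [Matrix.vecMul, dotProduct] using h1

variable [IsNoetherianRing Rᵐᵒᵖ]

lemma exists_kernel_matrix {m n : ℕ} (A : Matrix (Fin m) (Fin n) R) :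
    ∃ (k : ℕ) (B : Matrix (Fin n) (Fin k) R), A * B = 0 ∧
      ∀ v : Fin n → R, smulVec A v = 0 → ∃ w, v = smulVec B w := by
  let f : (Fin n → Rᵐᵒᵖ) →ₗ[Rᵐᵒᵖ] (Fin m → Rᵐᵒᵖ) :=
    Matrix.toLinearMapRight' (A.transpose.map MulOpposite.op)
  obtain ⟨k, g, hg⟩ := Submodule.fg_iff_exists_fin_generating_family.1
    (IsNoetherian.noetherian (LinearMap.ker f))
  refine ⟨k, Matrix.of fun i j => (g j i).unop, ?_, fun v hv => ?_⟩
  · ext i j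
    have hgj : g j ∈ LinearMap.ker f := hg ▸ Submodule.subset_span ⟨j, rfl⟩
    have := congrArg MulOpposite.unop (congrFun (LinearMap.mem_ker.1 hgj) i)
    simpa [f, Matrix.vecMul, dotProduct, Matrix.mul_apply] using this
  · have hvf : MulOpposite.op ∘ v ∈ LinearMap.ker f := by
      refine LinearMap.mem_ker.2 (funext fun i => ?_)
      have := congrArg MulOpposite.op (congrFun hv i)
      simpa [f, Matrix.vecMul, dotProduct, smulVec] using this
    rw [← hg, Submodule.mem_span_range_iff_exists_fun] at hvf
    obtain ⟨c, hc⟩ := hvf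
    refine ⟨fun j => (c j).unop, funext fun i => ?_⟩
    have := congrArg MulOpposite.unop (congrFun hc i)
    simpa [smulVec] using this.symm

lemma exists_of_matrix {m n : ℕ} (A : Matrix (Fin m) (Fin n) R) :
    ∃ (C : MatrixResolution R) (hm : C.rank 0 = m) (hn : C.rank 1 = n),
      C.mat 0 = A.submatrix (Fin.cast hm) (Fin.cast hn) := by
  choose k B hB₀ hB using fun s : Σ m n : ℕ, Matrix (Fin m) (Fin n) R =>
    exists_kernel_matrix s.2.2
  let s : ℕ → Σ m n : ℕ, Matrix (Fin m) (Fin n) R := fun i =>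
    Nat.rec ⟨m, n, A⟩ (fun _ s => ⟨s.2.1, k s, B s⟩) i
  exact ⟨⟨fun i => (s i).1, fun i => (s i).2.2, fun i => hB₀ (s i), fun i => hB (s i)⟩,
    rfl, rfl, rfl⟩

end MatrixResolution

section

variable {R : Type u} [Ring R]

lemma flatDimLE_of_injective {n : ℕ} (hr : InjDimLE n (ModuleCat.of Rᵐᵒᵖ Rᵐᵒᵖ)) {I : Type u}
    [AddCommGroup I] [Module R I] [Module.Injective R I] : FlatDimLE R n I := by
  intro C x hx
  let φ := Fintype.linearCombination R x
  let ρ := Matrix.toLinearMapRight' (C.mat (n + 1))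
  have hle : LinearMap.ker ρ ≤ LinearMap.ker φ := by
    intro v hv
    obtain ⟨w, rfl⟩ := C.exists_vecMul_eq hr le_rfl v hv
    have h1 (j) : ∑ i, C.mat n j i • x i = 0 := congrFun hx j
    simp only [φ, LinearMap.mem_ker, Fintype.linearCombination_apply, Matrix.vecMul, dotProduct,
      Finset.sum_smul, mul_smul]
    rw [Finset.sum_comm]
    simp [← Finset.smul_sum, h1]
  obtain ⟨ψ, hψ⟩ := Module.Injective.extension_property R I _ _
    ((LinearMap.ker ρ).liftQ ρ le_rfl)
    (LinearMap.ker_eq_bot.1 (Submodule.ker_liftQ_eq_bot' _ _ rfl))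
    ((LinearMap.ker ρ).liftQ φ hle)
  have hψ' (v) : ψ (ρ v) = φ v := LinearMap.congr_fun hψ (Submodule.Quotient.mk v)
  refine ⟨fun k => ψ (Pi.single k 1), funext fun j => ?_⟩
  have h1 := hψ' (Pi.single j 1)
  have h2 : ρ (Pi.single j 1) = ∑ k, C.mat (n + 1) j k • Pi.single k (1 : R) := by
    ext k
    simp [ρ, Finset.sum_apply, Pi.single_apply]
  rw [h2, map_sum] at h1
  simpa [φ, smulVec] using h1.symm

lemma FlatDimLE.exists_factorization [IsNoetherianRing R] [IsNoetherianRing Rᵐᵒᵖ] {L X : Type*}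
    [AddCommGroup L] [Module R L] (h : FlatDimLE R 0 L) [AddCommGroup X] [Module R X]
    [Module.Finite R X] (f : X →ₗ[R] L) :
    ∃ (k : ℕ) (a : X →ₗ[R] Fin k → R) (b : (Fin k → R) →ₗ[R] L), b ∘ₗ a = f := by
  obtain ⟨n, p, hp⟩ := Module.Finite.exists_fin' R X
  obtain ⟨m, g, hg⟩ := Submodule.fg_iff_exists_fin_generating_family.1
    (IsNoetherian.noetherian (LinearMap.ker p))
  obtain ⟨C, rfl, rfl, hC⟩ := MatrixResolution.exists_of_matrix (Matrix.of g)
  have hC' (i j) : C.mat 0 i j = g i j := by rw [hC]; rfl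
  have hg' (i) : g i = ∑ j, C.mat 0 i j • Pi.single j (1 : R) := by
    ext k
    simp [hC', Finset.sum_apply, Pi.single_apply]
  have hpg (i) : p (g i) = 0 := by
    have : g i ∈ LinearMap.ker p := hg ▸ Submodule.subset_span ⟨i, rfl⟩
    exact this
  obtain ⟨y, hy⟩ := h C (fun j => f (p (Pi.single j 1))) (funext fun i => by
    have := congrArg f (hpg i)
    rw [hg', map_sum, map_sum] at this
    simpa [smulVec] using this)
  let ρ := Matrix.toLinearMapRight' (C.mat (0 + 1))
  have hle : LinearMap.ker p ≤ LinearMap.ker ρ := by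
    rw [← hg, Submodule.span_le]
    rintro _ ⟨i, rfl⟩
    refine LinearMap.mem_ker.2 (funext fun j => ?_)
    have := congrFun (congrFun (C.mul_eq_zero 0) i) j
    simpa [ρ, Matrix.vecMul, dotProduct, Matrix.mul_apply, hC'] using this
  let e := p.quotKerEquivOfSurjective hp
  refine ⟨_, (LinearMap.ker p).liftQ ρ hle ∘ₗ e.symm.toLinearMap, Fintype.linearCombination R y,
    LinearMap.ext fun x => ?_⟩
  obtain ⟨v, rfl⟩ := hp x
  have he : e.symm (p v) = Submodule.Quotient.mk v := by
    rw [LinearEquiv.symm_apply_eq]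
    rfl
  have key : Fintype.linearCombination R y ∘ₗ ρ = f ∘ₗ p := by
    refine LinearMap.pi_ext' fun j => LinearMap.ext_ring ?_
    have := congrFun hy j
    simpa [ρ, Fintype.linearCombination_apply, smulVec] using this.symm
  simpa [he] using LinearMap.congr_fun key v

end

section

variable {R : Type u} [Ring R]

lemma subsingleton_ext_projective {P : ModuleCat.{u} R} (hP : Projective P) (Y : ModuleCat.{u} R)
    (n : ℕ) : Subsingleton (Abelian.Ext P Y (n + 1)) :=
  subsingleton_of_forall_eq 0 Abelian.Ext.eq_zero_of_projective

lemma flatDimLE_zero_of_ses {K P L : ModuleCat.{u} R} (hP : Projective P) (hS : SES K P L) {n : ℕ}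
    (h : FlatDimLE R (n + 1) L) : FlatDimLE R n K := by
  obtain ⟨f, g, w, hS⟩ := hS
  have : Module.Projective R P := (IsProjective.iff_projective P).2 hP
  exact .of_exact hS.moduleCat_injective_f hS.moduleCat_surjective_g
    ((ShortComplex.ShortExact.moduleCat_exact_iff_function_exact _).1 hS.exact) h

lemma FlatDimLE.hasProjectiveDimensionLE_of_subsingleton_ext (n : ℕ) {L : ModuleCat.{u} R}
    (hL : FlatDimLE R 0 L)
    (h : ∀ L' : ModuleCat.{u} R, FlatDimLE R 0 L' → Subsingleton (Abelian.Ext L L' (n + 1))) :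
    HasProjectiveDimensionLE L n := by
  induction n generalizing L with
  | zero =>
    obtain ⟨K, P, hP, hS⟩ := exists_ses_projective L
    exact (projective_iff_hasProjectiveDimensionLE_zero L).1 (projective_of_ses hP hS
      (ext1IsZero_iff.2 (h K (flatDimLE_zero_of_ses hP hS hL.succ))))
  | succ n ih =>
    obtain ⟨K, P, hP, hS⟩ := exists_ses_projective L
    have hK := flatDimLE_zero_of_ses hP hS hL.succ
    obtain ⟨f, g, w, hS⟩ := hS
    exact (hS.hasProjectiveDimensionLT_X₃_iff n hP).2
      (ih hK fun L' hL' => (subsingleton_ext_syzygy hS hP L' n).2 (h L' hL'))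

variable [IsNoetherianRing R] [IsNoetherianRing Rᵐᵒᵖ]

lemma FlatDimLE.subsingleton_ext {L : ModuleCat.{u} R} (hL : FlatDimLE R 0 L) (n : ℕ)
    (X : Type u) [AddCommGroup X] [Module R X] [Module.Finite R X]
    (h : Subsingleton (Abelian.Ext (ModuleCat.of R X) (ModuleCat.of R R) (n + 1))) :
    Subsingleton (Abelian.Ext (ModuleCat.of R X) L (n + 1)) := by
  induction n generalizing X with
  | zero =>
    obtain ⟨m, p, hp⟩ := Module.Finite.exists_fin' R X
    have hS := LinearMap.shortExact_shortComplexKer hp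
    refine subsingleton_ext_of_exists_extension hS
      (subsingleton_ext_projective (ModuleCat.projective_of_free (Pi.basisFun R (Fin m))) _ 0)
      fun f => ?_
    obtain ⟨k, a, b, hab⟩ := hL.exists_factorization f.hom
    choose a' ha' using fun j => exists_extension_of_subsingleton_ext hS h
      (ModuleCat.ofHom (LinearMap.proj j ∘ₗ a))
    refine ⟨ModuleCat.ofHom (b ∘ₗ LinearMap.pi fun j => (a' j).hom), ModuleCat.hom_ext ?_⟩
    rw [← hab]
    refine LinearMap.ext fun x => congrArg b (funext fun j => ?_)
    exact congr(($(ha' j)).hom x)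
  | succ n ih =>
    obtain ⟨m, p, hp⟩ := Module.Finite.exists_fin' R X
    have hS := LinearMap.shortExact_shortComplexKer hp
    have hP := ModuleCat.projective_of_free (M := ModuleCat.of R (Fin m → R))
      (Pi.basisFun R (Fin m))
    exact (subsingleton_ext_syzygy hS hP _ n).1
      (ih (LinearMap.ker p) ((subsingleton_ext_syzygy hS hP _ n).2 h))

lemma FlatDimLE.hasInjectiveDimensionLE {n : ℕ}
    (hl : HasInjectiveDimensionLE (ModuleCat.of R R) n) {L : ModuleCat.{u} R}
    (hL : FlatDimLE R 0 L) : HasInjectiveDimensionLE L n :=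
  hasInjectiveDimensionLE_of_subsingleton_ext n L fun J => hL.subsingleton_ext n (R ⧸ J)
    (HasInjectiveDimensionLT.subsingleton _ (n + 1) (n + 1) le_rfl _)

lemma FlatDimLE.hasProjectiveDimensionLE {n : ℕ}
    (hl : HasInjectiveDimensionLE (ModuleCat.of R R) n) (m : ℕ) {M : ModuleCat.{u} R}
    (hM : FlatDimLE R m M) : HasProjectiveDimensionLE M (m + n) := by
  induction m generalizing M with
  | zero =>
    rw [Nat.zero_add]
    refine hM.hasProjectiveDimensionLE_of_subsingleton_ext n fun L' hL' => ?_
    have := hL'.hasInjectiveDimensionLE hl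
    exact HasInjectiveDimensionLT.subsingleton _ (n + 1) (n + 1) le_rfl _
  | succ m ih =>
    obtain ⟨K, P, hP, hS⟩ := exists_ses_projective M
    have hK := ih (flatDimLE_zero_of_ses hP hS hM)
    obtain ⟨f, g, w, hS⟩ := hS
    rw [Nat.succ_add]
    exact (hS.hasProjectiveDimensionLT_X₃_iff (m + n) hP).2 hK

/-- Over a Gorenstein ring, modules of finite injective dimension have bounded projective
dimension. -/
lemma hasProjectiveDimensionLE_of_hasFiniteInjDim {m n : ℕ}
    (hl : HasInjectiveDimensionLE (ModuleCat.of R R) n)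
    (hr : InjDimLE m (ModuleCat.of Rᵐᵒᵖ Rᵐᵒᵖ)) {M : ModuleCat.{u} R} (hM : HasFiniteInjDim M) :
    HasProjectiveDimensionLE M (m + n) := by
  obtain ⟨k, hk⟩ := hM
  have hinj {I : ModuleCat.{u} R} (hI : Injective I) : HasProjectiveDimensionLE I (m + n) := by
    have : Module.Injective R I := Module.injective_module_of_injective_object (inj := hI)
    exact FlatDimLE.hasProjectiveDimensionLE hl m (flatDimLE_of_injective hr)
  induction k generalizing M with
  | zero => exact hinj hk
  | succ k ih =>
    obtain ⟨I, M', hI, ⟨f, g, w, hS⟩, hM'⟩ := hk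
    have h' := ih hM'
    exact hS.hasProjectiveDimensionLT_X₁ _ (hinj hI)
      (hasProjectiveDimensionLT_of_ge _ _ _ (Nat.le_succ _))

/-- If all projectives have injective dimension at most `n`, so do all modules of finite
projective dimension. -/
lemma hasInjectiveDimensionLE_of_hasFiniteProjDim {n : ℕ}
    (hl : HasInjectiveDimensionLE (ModuleCat.of R R) n) {M : ModuleCat.{u} R}
    (hM : HasFiniteProjDim M) : HasInjectiveDimensionLE M n := by
  obtain ⟨k, hk⟩ := hM
  have hproj {P : ModuleCat.{u} R} (hP : Projective P) : HasInjectiveDimensionLE P n := by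
    have : Module.Projective R P := (IsProjective.iff_projective P).2 hP
    exact FlatDimLE.hasInjectiveDimensionLE hl flatDimLE_of_projective
  induction k generalizing M with
  | zero => exact hproj hk
  | succ k ih =>
    obtain ⟨P, M', hP, ⟨f, g, w, hS⟩, hM'⟩ := hk
    have h' := ih hM'
    exact hS.hasInjectiveDimensionLT_X₃ _ (hproj hP)
      (hasInjectiveDimensionLT_of_ge _ _ _ (Nat.le_succ _))

end

/-- A linear map into a free module factors through a free module of bounded rank. -/
lemma exists_comp_comp_eq_finsupp {R : Type*} [Ring R] {K X : Type*} [AddCommGroup K] [Module R K]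
    (g : K →ₗ[R] X →₀ R) :
    ∃ (a : (X →₀ R) →ₗ[R] (K × ℕ) →₀ R) (b : ((K × ℕ) →₀ R) →ₗ[R] (X →₀ R)),
      b ∘ₗ a ∘ₗ g = g := by
  rcases isEmpty_or_nonempty X with hX | hX
  · exact ⟨0, 0, LinearMap.ext fun x => Subsingleton.elim _ _⟩
  choose idx hidx using fun k => Set.countable_iff_exists_injOn.1
    (g k).support.finite_toSet.countable
  have key (x : X) : ∃ k, (∃ k', x ∈ (g k').support) → x ∈ (g k).support := by
    by_cases h : ∃ k', x ∈ (g k').support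
    · exact ⟨h.choose, fun _ => h.choose_spec⟩
    · exact ⟨0, fun h' => absurd h' h⟩
  choose k hk using key
  let s (x : X) : K × ℕ := (k x, idx (k x) x)
  have hs : Set.InjOn s {x | ∃ k', x ∈ (g k').support} := by
    intro x hx y hy hxy
    obtain ⟨h₁, h₂⟩ := Prod.ext_iff.1 hxy
    dsimp [s] at h₁ h₂
    rw [← h₁] at h₂
    exact hidx (k x) (hk x hx) (by rw [h₁]; exact hk y hy) h₂
  refine ⟨Finsupp.lmapDomain R R s,
    Finsupp.lmapDomain R R (Function.invFunOn s {x | ∃ k', x ∈ (g k').support}),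
    LinearMap.ext fun z => ?_⟩
  simp only [LinearMap.comp_apply, Finsupp.lmapDomain_apply]
  rw [← Finsupp.mapDomain_comp]
  refine (Finsupp.mapDomain_congr fun x hx => ?_).trans Finsupp.mapDomain_id
  exact hs.leftInvOn_invFunOn ⟨z, hx⟩

section

variable {R : Type u} [Ring R]

lemma projective_finsupp (X : Type u) : Projective (ModuleCat.of R (X →₀ R)) :=
  ModuleCat.projective_of_free Finsupp.basisSingleOne

lemma exists_epi_free (M : ModuleCat.{u} R) :
    ∃ (X : Type u) (p : ModuleCat.of R (X →₀ R) ⟶ M), Epi p :=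
  ⟨M, ModuleCat.ofHom (Finsupp.linearCombination R id),
    (ModuleCat.epi_iff_surjective _).2 fun m => ⟨Finsupp.single m 1, by simp⟩⟩

variable [IsNoetherianRing R] [IsNoetherianRing Rᵐᵒᵖ]

lemma FlatDimLE.hasFiniteInjDim {n : ℕ} (hl : HasInjectiveDimensionLE (ModuleCat.of R R) n)
    {L : ModuleCat.{u} R} (hL : FlatDimLE R 0 L) : HasFiniteInjDim L :=
  hasFiniteInjDim_iff.2 ⟨n, hL.hasInjectiveDimensionLE hl⟩

lemma hasFiniteInjDim_of_projective {n : ℕ} (hl : HasInjectiveDimensionLE (ModuleCat.of R R) n)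
    {P : ModuleCat.{u} R} (hP : Projective P) : HasFiniteInjDim P := by
  have : Module.Projective R P := (IsProjective.iff_projective P).2 hP
  exact FlatDimLE.hasFiniteInjDim hl flatDimLE_of_projective

lemma exists_lift_of_mem_leftPerp {n : ℕ} (hl : HasInjectiveDimensionLE (ModuleCat.of R R) n)
    {K : ModuleCat.{u} R} (hK : K ∈ leftPerp {M : ModuleCat.{u} R | HasFiniteInjDim M})
    {P Y : ModuleCat.{u} R} (hP : Projective P) (hY : HasFiniteInjDim Y) (p : P ⟶ Y) [Epi p]
    (f : K ⟶ Y) : ∃ g : K ⟶ P, g ≫ p = f := by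
  have hS : IsSES (kernel.ι p) p := ⟨by simp,
    .mk' (ShortComplex.exact_of_f_is_kernel _ (kernelIsKernel _)) inferInstance inferInstance⟩
  have hker := (isThick_hasFiniteInjDim.2 hS.ses).2.2 (hasFiniteInjDim_of_projective hl hP) hY
  exact (hK _ hker).lift hS f

lemma exists_ses_of_mem_leftPerp {n : ℕ} (hl : HasInjectiveDimensionLE (ModuleCat.of R R) n)
    {K : ModuleCat.{u} R} (hK : K ∈ leftPerp {M : ModuleCat.{u} R | HasFiniteInjDim M}) :
    ∃ P : ModuleCat.{u} R, Projective P ∧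
      ∃ X' ∈ leftPerp {M : ModuleCat.{u} R | HasFiniteInjDim M}, SES K P X' := by
  let F := (K × ℕ) →₀ R
  let D := (K →ₗ[R] F) → F
  have hD : HasFiniteInjDim (ModuleCat.of R D) :=
    FlatDimLE.hasFiniteInjDim hl (.pi fun _ => flatDimLE_of_projective)
  obtain ⟨X₀, π, _⟩ := exists_epi_free (ModuleCat.of R D)
  obtain ⟨i, hi⟩ := exists_lift_of_mem_leftPerp hl hK (projective_finsupp X₀) hD π
    (ModuleCat.ofHom (LinearMap.pi fun f => f))
  have hext {X : Type u} (g : K ⟶ ModuleCat.of R (X →₀ R)) : ∃ h, i ≫ h = g := by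
    obtain ⟨a, b, hab⟩ := exists_comp_comp_eq_finsupp g.hom
    refine ⟨π ≫ ModuleCat.ofHom (b ∘ₗ LinearMap.proj (a ∘ₗ g.hom)), ?_⟩
    rw [reassoc_of% hi]
    exact ModuleCat.hom_ext hab
  have hmono : Mono i := by
    obtain ⟨X, p, _⟩ := exists_epi_free (Injective.under K)
    obtain ⟨g, hg⟩ := exists_lift_of_mem_leftPerp hl hK (projective_finsupp X)
      (hasFiniteInjDim_of_injective (inferInstanceAs (Injective (Injective.under K)))) p
      (Injective.ι K)
    obtain ⟨h, rfl⟩ := hext g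
    rw [Category.assoc] at hg
    have : Mono (i ≫ h ≫ p) := hg ▸ inferInstance
    exact mono_of_mono i (h ≫ p)
  have hS : (ShortComplex.mk i (cokernel.π i) (by simp)).ShortExact :=
    .mk' (ShortComplex.exact_of_g_is_cokernel _ (cokernelIsCokernel _)) inferInstance inferInstance
  refine ⟨_, projective_finsupp X₀, cokernel i, fun Y hY => ?_, _, _, _, hS⟩
  refine ext1IsZero_iff.2 (subsingleton_ext_of_exists_extension hS
    (subsingleton_ext_projective (projective_finsupp X₀) Y 0) fun f => ?_)
  obtain ⟨X, p, _⟩ := exists_epi_free Y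
  obtain ⟨g, rfl⟩ := exists_lift_of_mem_leftPerp hl hK (projective_finsupp X) hY p f
  obtain ⟨h, rfl⟩ := hext g
  exact ⟨h ≫ p, by simp⟩

end

section

variable {R : Type u} [Ring R]

lemma injective_dfinsupp [IsNoetherianRing R] {ι : Type u} (E : ι → Type u)
    [∀ i, AddCommGroup (E i)] [∀ i, Module R (E i)] [∀ i, Module.Injective R (E i)] :
    Module.Injective R (Π₀ i, E i) := by
  classical
  refine Module.Baer.injective fun J g => ?_
  obtain ⟨s, hs⟩ := isNoetherian_def.1 (inferInstance : IsNoetherian R J) ⊤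
  let T : Finset ι := s.biUnion fun x => (g x).support
  have hT (x : J) (i : ι) (hi : i ∉ T) : g x i = 0 := by
    have hx : x ∈ Submodule.span R (s : Set J) := hs ▸ Submodule.mem_top
    induction hx using Submodule.span_induction with
    | mem y hy =>
      by_contra h
      exact hi (Finset.mem_biUnion.2 ⟨y, hy, DFinsupp.mem_support_iff.2 h⟩)
    | zero => simp
    | add y z _ _ hy hz => simp [hy, hz]
    | smul a y _ hy => simp [hy]
  choose h hh using fun i => Module.Baer.of_injective (inferInstanceAs (Module.Injective R (E i))) J
    (DFinsupp.lapply i ∘ₗ g)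
  refine ⟨LinearMap.toSpanSingleton R _ (DFinsupp.mk T fun i => h i 1), fun x hx => ?_⟩
  ext i
  by_cases hi : i ∈ T
  · have := (h i).map_smul x 1
    rw [smul_eq_mul, mul_one, hh i x hx] at this
    simp_all
  · simp [hi, hT ⟨x, hx⟩ i hi]

lemma exists_maximal_disjoint {M : Type*} [AddCommGroup M] [Module R M] {N L : Submodule R M}
    (h : Disjoint N L) :
    ∃ N' ≥ N, Disjoint N' L ∧ ∀ N'' ≥ N', Disjoint N'' L → N'' ≤ N' := by
  obtain ⟨N', hN, h', hmax⟩ := zorn_le_nonempty₀ {N' : Submodule R M | Disjoint N' L}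
    (fun c hc hchain y hy => ⟨sSup c, hchain.directedOn.disjoint_sSup_left.2 hc,
      fun z hz => le_sSup hz⟩) N h
  exact ⟨N', hN, h', fun N'' h₁ h₂ => hmax h₂ h₁⟩

lemma exists_retraction_of_maximal_disjoint {C : Type u} [AddCommGroup C] [Module R C]
    [Module.Injective R C] {N L : Submodule R C} (h : Disjoint N L)
    (hmax : ∀ N' ≥ N, Disjoint N' L → N' ≤ N) :
    ∃ r : C →ₗ[R] N, ∀ n : N, r n = n := by
  obtain ⟨L', hL, hL', hLmax⟩ := exists_maximal_disjoint h.symm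
  have hinj : Function.Injective (L'.mkQ ∘ₗ N.subtype) := by
    rw [← LinearMap.ker_eq_bot, LinearMap.ker_comp, Submodule.ker_mkQ]
    exact Submodule.disjoint_iff_comap_eq_bot.1 hL'.symm
  obtain ⟨g, hg⟩ := Module.Injective.extension_property R C _ _ _ hinj N.subtype
  let G := g ∘ₗ L'.mkQ
  have hG (n : N) : G n = n := DFunLike.congr_fun hg n
  have hGL (x) (hx : x ∈ L') : G x = 0 := by simp [G, (Submodule.Quotient.mk_eq_zero _).2 hx]
  have hT : L.comap G ≤ L' := hLmax _ (fun x hx => by simp [hGL x hx]) <| by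
    rw [Submodule.disjoint_def]
    intro x hx hxN
    rw [Submodule.mem_comap, hG ⟨x, hxN⟩] at hx
    exact Submodule.disjoint_def.1 h x hxN hx
  have hR : LinearMap.range G ≤ N := by
    refine hmax _ (fun n hn => ⟨n, hG ⟨n, hn⟩⟩) ?_
    rw [Submodule.disjoint_def]
    rintro _ ⟨x, rfl⟩ hx
    exact hGL _ (hT hx)
  exact ⟨G.codRestrict N fun x => hR ⟨x, rfl⟩, fun n => Subtype.ext (hG n)⟩

lemma injective_of_retract {M N : Type u} [AddCommGroup M] [Module R M] [AddCommGroup N]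
    [Module R N] [Module.Injective R M] (i : N →ₗ[R] M) (r : M →ₗ[R] N) (h : ∀ n, r (i n) = n) :
    Module.Injective R N where
  out X Y _ _ _ _ f hf g := by
    obtain ⟨k, hk⟩ := Module.Injective.out f hf (i ∘ₗ g)
    exact ⟨r ∘ₗ k, fun x => by simp [hk, h]⟩

lemma sSupIndep_insert {α : Type*} [CompleteLattice α] [IsModularLattice α] {s : Set α} {a : α}
    (hs : sSupIndep s) (ha : Disjoint a (sSup s)) : sSupIndep (insert a s) := by
  intro x hx
  obtain rfl | hxa := eq_or_ne x a
  · exact ha.mono_right (sSup_le_sSup (by simp))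
  have hxs := hx.resolve_left hxa
  rw [← Set.insert_sdiff_singleton_comm hxa.symm, sSup_insert, sup_comm]
  refine (hs hxs).disjoint_sup_right_of_disjoint_sup_left (ha.mono_right ?_).symm
  exact sup_le (le_sSup hxs) (sSup_le_sSup Set.sdiff_subset)

end

section

variable {R : Type u} [Ring R]

lemma exists_decomposition_of_injective [IsNoetherianRing R] {C : Type u} [AddCommGroup C]
    [Module R C] [Module.Injective R C] {E : Ideal R → Type u} [∀ J, AddCommGroup (E J)]
    [∀ J, Module R (E J)] [∀ J, Module.Injective R (E J)] (j : ∀ J, R →ₗ[R] E J)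
    (hj : ∀ J, LinearMap.ker (j J) = J) :
    ∃ (S : Set (Submodule R C)) (r : C →ₗ[R] Π₀ N : S, N),
      (∀ N ∈ S, ∃ (J : Ideal R) (i : N →ₗ[R] E J) (p : E J →ₗ[R] N), ∀ n, p (i n) = n) ∧
      ∀ x, DFinsupp.lsum ℕ (fun N : S => N.1.subtype) (r x) = x := by
  let 𝒮 : Set (Submodule R C) := {N | Module.Injective R N ∧
    ∃ (J : Ideal R) (i : N →ₗ[R] E J) (p : E J →ₗ[R] N), ∀ n, p (i n) = n}
  obtain ⟨S, hS⟩ := zorn_subset {S : Set (Submodule R C) | sSupIndep S ∧ S ⊆ 𝒮}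
    fun c hc hchain => ⟨⋃₀ c,
      ⟨iSupIndep_sUnion_of_directed hchain.directedOn fun s hs => (hc hs).1,
        Set.sUnion_subset fun s hs => (hc hs).2⟩,
      fun _ => Set.subset_sUnion_of_mem⟩
  have hind := hS.prop.1
  have hmem := hS.prop.2
  let l := DFinsupp.lsum ℕ (fun N : S => N.1.subtype)
  have hl : Function.Injective l := ((sSupIndep_iff _).1 hind).dfinsupp_lsum_injective
  have hrange : sSup S = LinearMap.range l := by
    rw [sSup_eq_iSup', Submodule.iSup_eq_range_dfinsupp_lsum]
  have (N : S) : Module.Injective R N := (hmem N.2).1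
  have := injective_dfinsupp (R := R) fun N : S => N.1
  obtain ⟨r, hr⟩ := Module.Injective.extension_property R _ _ _ l hl LinearMap.id
  have hr (d) : r (l d) = d := DFunLike.congr_fun hr d
  refine ⟨S, r, fun N hN => (hmem hN).2, fun y => ?_⟩
  by_contra hy
  let x := y - l (r y)
  have hx : x ≠ 0 := fun h => hy (sub_eq_zero.1 h).symm
  have hrx : r x = 0 := by simp [x, hr]
  let J : Ideal R := LinearMap.ker (LinearMap.toSpanSingleton R C x)
  let k : (R ⧸ J) →ₗ[R] C := J.liftQ (LinearMap.toSpanSingleton R C x) le_rfl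
  have hk : Function.Injective k := LinearMap.ker_eq_bot.1 (Submodule.ker_liftQ_eq_bot _ _ _ le_rfl)
  obtain ⟨f₀, hf₀⟩ := Module.Injective.extension_property R (E J) _ _ k hk
    (J.liftQ (j J) (hj J).ge)
  have hf₀ (a : R) : f₀ (a • x) = j J a := by
    simpa [k] using DFunLike.congr_fun hf₀ (Submodule.Quotient.mk a)
  let f := f₀ ∘ₗ (LinearMap.id - l ∘ₗ r)
  have hfx (a : R) : f (a • x) = j J a := by simp [f, hrx, ← hf₀]
  have hSf : sSup S ≤ LinearMap.ker f := by
    rw [hrange]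
    rintro _ ⟨d, rfl⟩
    simp [f, hr]
  have hdisj : Disjoint (Submodule.span R {x}) (LinearMap.ker f) := by
    rw [Submodule.disjoint_def]
    intro z hz hzf
    obtain ⟨a, rfl⟩ := Submodule.mem_span_singleton.1 hz
    rw [LinearMap.mem_ker, hfx, ← LinearMap.mem_ker, hj] at hzf
    exact hzf
  obtain ⟨N, hxN, hNf, hmax⟩ := exists_maximal_disjoint hdisj
  obtain ⟨q, hq⟩ := exists_retraction_of_maximal_disjoint hNf hmax
  have hNinj : Module.Injective R N := injective_of_retract N.subtype q hq
  have hfN : Function.Injective (f ∘ₗ N.subtype) := by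
    rw [← LinearMap.ker_eq_bot, LinearMap.ker_comp]
    exact Submodule.disjoint_iff_comap_eq_bot.1 hNf
  obtain ⟨p, hp⟩ := Module.Injective.extension_property R N _ _ _ hfN LinearMap.id
  have hN : N ∈ S := hS.le_of_ge
    (y := insert N S) ⟨sSupIndep_insert hind (hNf.mono_right hSf),
      Set.insert_subset ⟨hNinj, J, _, p, DFunLike.congr_fun hp⟩ hmem⟩
    (Set.subset_insert _ _) (Set.mem_insert _ _)
  have hxN := hxN (Submodule.mem_span_singleton_self x)
  exact hx (Submodule.disjoint_def.1 hNf x hxN (hSf (le_sSup hN hxN)))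

lemma exists_injective_factorization [IsNoetherianRing R] (K : Type u) [AddCommGroup K]
    [Module R K] :
    ∃ (I : Type u) (_ : AddCommGroup I) (_ : Module R I) (_ : Module.Injective R I)
      (q : I →ₗ[R] K), ∀ (C : Type u) [AddCommGroup C] [Module R C] [Module.Injective R C]
      (f : C →ₗ[R] K), ∃ g : C →ₗ[R] I, q ∘ₗ g = f := by
  classical
  let E (J : Ideal R) : ModuleCat.{u} R := Injective.under (ModuleCat.of R (R ⧸ J))
  have (J : Ideal R) : Module.Injective R (E J) :=
    have : Injective (ModuleCat.of R (E J)) :=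
      inferInstanceAs (Injective (Injective.under (ModuleCat.of R (R ⧸ J))))
    Module.injective_module_of_injective_object _ _
  let j (J : Ideal R) : R →ₗ[R] E J := (Injective.ι (ModuleCat.of R (R ⧸ J))).hom ∘ₗ J.mkQ
  have hj (J : Ideal R) : LinearMap.ker (j J) = J := by
    rw [LinearMap.ker_comp, LinearMap.ker_eq_bot.2 ((ModuleCat.mono_iff_injective _).1
      (inferInstanceAs (Mono (Injective.ι (ModuleCat.of R (R ⧸ J))))))]
    exact Submodule.ker_mkQ J
  let ι := Σ J : Ideal R, (E J →ₗ[R] K)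
  refine ⟨Π₀ i : ι, E i.1, inferInstance, inferInstance, injective_dfinsupp fun i : ι => E i.1,
    DFinsupp.lsum ℕ fun i => i.2, fun C _ _ _ f => ?_⟩
  obtain ⟨S, r, hS, hr⟩ := exists_decomposition_of_injective (C := C) j hj
  choose J i p hip using hS
  let ψ (N : S) : N →ₗ[R] Π₀ i : ι, E i.1 :=
    DFinsupp.lsingle (⟨J N N.2, f ∘ₗ N.1.subtype ∘ₗ p N N.2⟩ : ι) ∘ₗ i N N.2
  refine ⟨DFinsupp.lsum ℕ ψ ∘ₗ r, LinearMap.ext fun x => ?_⟩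
  conv_rhs => rw [← hr x]
  simp only [LinearMap.comp_apply]
  generalize r x = d
  induction d using DFinsupp.induction with
  | h0 => simp
  | ha N b d _ _ hd =>
    rw [map_add, map_add, map_add, map_add, hd]
    congr 1
    simp [ψ, hip]

end

section

variable {R : Type u} [Ring R] [IsNoetherianRing R] [IsNoetherianRing Rᵐᵒᵖ]

lemma exists_ses_of_mem_rightPerp {n : ℕ} (hl : HasInjectiveDimensionLE (ModuleCat.of R R) n)
    {K : ModuleCat.{u} R} (hK : K ∈ rightPerp {M : ModuleCat.{u} R | HasFiniteInjDim M}) :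
    ∃ I : ModuleCat.{u} R, Injective I ∧
      ∃ X' ∈ rightPerp {M : ModuleCat.{u} R | HasFiniteInjDim M}, SES X' I K := by
  obtain ⟨I, _, _, hI, q, hq⟩ := exists_injective_factorization (R := R) K
  have key {Y : ModuleCat.{u} R} (hY : HasFiniteInjDim Y) (f : Y ⟶ K) :
      ∃ g : Y ⟶ ModuleCat.of R I, g ≫ ModuleCat.ofHom q = f := by
    obtain ⟨U, i, hU, hi⟩ : ∃ (U : ModuleCat.{u} R) (i : Y ⟶ U), Injective U ∧ Mono i :=
      ⟨Injective.under Y, Injective.ι Y, inferInstance, inferInstance⟩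
    have hS : (ShortComplex.mk i (cokernel.π i) (cokernel.condition i)).ShortExact :=
      .mk' (ShortComplex.exact_of_g_is_cokernel _ (cokernelIsCokernel _)) inferInstance
        inferInstance
    have hcok : HasFiniteInjDim (cokernel i) :=
      (isThick_hasFiniteInjDim.2 ⟨_, _, _, hS⟩).1 hY (hasFiniteInjDim_of_injective hU)
    obtain ⟨f', rfl⟩ := exists_extension_of_subsingleton_ext hS (ext1IsZero_iff.1 (hK _ hcok)) f
    have : Module.Injective R U :=
      have : Injective (ModuleCat.of R U) := hU
      Module.injective_module_of_injective_object _ _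
    obtain ⟨g, hg⟩ := hq U f'.hom
    refine ⟨i ≫ ModuleCat.ofHom g, ?_⟩
    rw [Category.assoc]
    exact congrArg _ (ModuleCat.hom_ext hg)
  have hIinj : Injective (ModuleCat.of R I) := Module.injective_object_of_injective_module R I
  have : Epi (ModuleCat.ofHom q) := by
    obtain ⟨X, p, _⟩ := exists_epi_free K
    obtain ⟨g, rfl⟩ := key (hasFiniteInjDim_of_projective hl (projective_finsupp X)) p
    exact epi_of_epi g _
  have hS : (ShortComplex.mk (kernel.ι (ModuleCat.ofHom q)) (ModuleCat.ofHom q)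
      (by simp)).ShortExact :=
    .mk' (ShortComplex.exact_of_f_is_kernel _ (kernelIsKernel _)) inferInstance inferInstance
  refine ⟨_, hIinj, _, fun Y hY => ?_, _, _, _, hS⟩
  exact ext1IsZero_iff.2 (subsingleton_ext_of_exists_lift hS
    (ext1IsZero_iff.1 (ext1IsZero_of_injective hIinj)) fun f => key hY f)

end

end AbModel

/-- Theorem (Hovey; Gorenstein model structures): let `R` be a Gorenstein ring, i.e.
left and right Noetherian with finite injective dimension as a left and as a right
module over itself.  Let `W` be the class of left `R`-modules of finite injective
dimension (which coincides with the class of modules of finite projective dimension),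
`GP = ᗮW` the Gorenstein projectives and `GI = Wᗮ` the Gorenstein injectives.  Then
`W` is thick, `(GP, W)` and `(W, GI)` are complete cotorsion pairs, `GP ∩ W` is the
class of projective modules and `W ∩ GI` is the class of injective modules; that is,
`(GP, W, All)` and `(All, W, GI)` are Hovey triples on `R`-Mod. -/
theorem gorenstein_hovey_triples (R : Type u) [Ring R]
    [IsNoetherianRing R] [IsNoetherianRing Rᵐᵒᵖ]
    (hl : HasFiniteInjDim (ModuleCat.of R R))
    (hr : HasFiniteInjDim (ModuleCat.of Rᵐᵒᵖ Rᵐᵒᵖ)) :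
    (∀ M : ModuleCat.{u} R, HasFiniteInjDim M ↔ HasFiniteProjDim M) ∧
    IsThick {M : ModuleCat.{u} R | HasFiniteInjDim M} ∧
    IsCompleteCotorsionPair
      (leftPerp {M : ModuleCat.{u} R | HasFiniteInjDim M})
      {M : ModuleCat.{u} R | HasFiniteInjDim M} ∧
    IsCompleteCotorsionPair
      {M : ModuleCat.{u} R | HasFiniteInjDim M}
      (rightPerp {M : ModuleCat.{u} R | HasFiniteInjDim M}) ∧
    leftPerp {M : ModuleCat.{u} R | HasFiniteInjDim M} ∩
        {M : ModuleCat.{u} R | HasFiniteInjDim M} =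
      {M : ModuleCat.{u} R | Projective M} ∧
    {M : ModuleCat.{u} R | HasFiniteInjDim M} ∩
        rightPerp {M : ModuleCat.{u} R | HasFiniteInjDim M} =
      {M : ModuleCat.{u} R | Injective M} ∧
    IsHoveyTriple (leftPerp {M : ModuleCat.{u} R | HasFiniteInjDim M})
      {M : ModuleCat.{u} R | HasFiniteInjDim M} Set.univ ∧
    IsHoveyTriple (Set.univ)
      {M : ModuleCat.{u} R | HasFiniteInjDim M}
      (rightPerp {M : ModuleCat.{u} R | HasFiniteInjDim M}) := by
  obtain ⟨n, hn⟩ := hl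
  obtain ⟨m, hm⟩ := hr
  rw [injDimLE_iff] at hn
  have hproj (M : ModuleCat.{u} R) (hM : HasFiniteInjDim M) :
      HasProjectiveDimensionLE M (m + n) := hasProjectiveDimensionLE_of_hasFiniteInjDim hn hm hM
  refine hovey_triples_of_bounds (m + n) (fun M hM => ?_) hproj
    (fun M hM => hasFiniteInjDim_iff.2 ⟨n, hasInjectiveDimensionLE_of_hasFiniteProjDim hn hM⟩)
    (fun X hX => exists_ses_of_mem_leftPerp hn hX) (fun X hX => exists_ses_of_mem_rightPerp hn hX)
  have := hasInjectiveDimensionLE_of_hasFiniteProjDim hn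
    ⟨m + n, (projDimLE_iff _ _).2 (hproj M hM)⟩
  exact hasInjectiveDimensionLT_of_ge M (n + 1) (m + n + 1) (by lia)
end

section
/- Let 𝒜 be an abelian category and let (𝒬, 𝒲, ℛ) be a Hovey triple in the category Ch(𝒜) of chain complexes over 𝒜. Assume the core 𝒬 ∩ 𝒲 ∩ ℛ is closed under suspensions (shifts). Then every complex W ∈ 𝒬 ∩ 𝒲 ∩ ℛ is contractible, i.e., the identity chain map of W is chain homotopic to the zero map. -/
open CategoryTheory Limits ZeroObject

open AbModel

open CochainComplex in
/-- If every extension of `X⟦1⟧` by `X` splits, then `X` is contractible: a retraction of the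
inclusion of `X` into the (contractible) cone of `𝟙 X` exhibits `X` as a retract of it. -/
theorem nonempty_homotopy_id_zero_of_ext1IsZero_shift
    {A : Type*} [Category A] [Abelian A] {X : CochainComplex A ℤ}
    (hX : Ext1IsZero ((CochainComplex.shiftFunctor A (1 : ℤ)).obj X) X) :
    Nonempty (Homotopy (𝟙 X) 0) := by
  obtain ⟨s⟩ := hX _ _ (mappingCone.triangleRotateShortComplex (𝟙 X)).zero
    (HomologicalComplex.shortExact_of_degreewise_shortExact _ fun n =>
      (mappingCone.triangleRotateShortComplexSplitting (𝟙 X) n).shortExact)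
  obtain ⟨r, hr⟩ : ∃ r : mappingCone (𝟙 X) ⟶ X, mappingCone.inr (𝟙 X) ≫ r = 𝟙 X := ⟨s.r, s.f_r⟩
  exact ⟨(Homotopy.ofEq (by simp [hr])).trans
    ((((mappingCone.homotopyToZeroOfId X).compRight r).compLeft
      (mappingCone.inr (𝟙 X))).trans (Homotopy.ofEq (by simp)))⟩

/-- Lemma: let `(Q, W, R)` be a Hovey triple on the category of (ℤ-indexed) chain
complexes over an abelian category `A`, whose core `Q ∩ W ∩ R` is closed under
suspensions (shifts).  Then every complex in the core is contractible, i.e. its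
identity chain map is chain homotopic to zero. -/
theorem core_objects_contractible_of_closed_under_suspension
    {A : Type*} [Category A] [Abelian A]
    {Q W R : Set (CochainComplex A ℤ)}
    (h : IsHoveyTriple Q W R)
    (hshift : ∀ X ∈ Q ∩ W ∩ R, ∀ n : ℤ,
      (CochainComplex.shiftFunctor A n).obj X ∈ Q ∩ W ∩ R) :
    ∀ X ∈ Q ∩ W ∩ R, Nonempty (Homotopy (𝟙 X) 0) := by
  intro X hX
  have hQ : Q = leftPerp (W ∩ R) := h.2.1.1.1
  have hX1 : (CochainComplex.shiftFunctor A (1 : ℤ)).obj X ∈ leftPerp (W ∩ R) :=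
    hQ ▸ (hshift X hX 1).1.1
  exact nonempty_homotopy_id_zero_of_ext1IsZero_shift (hX1 X ⟨hX.1.2, hX.2⟩)
end
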